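/- arXiv:1406.0064 — 14 statements merged into one kernel-verified Lean document; each statement's English description precedes it below -/
import Mathlib

section
/- Let U ⊆ ℝ be a nonempty open interval and let f : U → ℝ be continuous and strictly monotone with f(U) = (0, ∞). Let a > 0 with a ≠ 1. Suppose g : U → ℝ is continuous and strictly monotone and that for every n ∈ ℕ there exist real numbers pₙ and qₙ such that g(f⁻¹(a^(3⁻ⁿ) · f(x))) = pₙ · g(x) + qₙ for all x ∈ U. Then either there exist α ≠ 0, β ≠ 0 and γ ∈ ℝ with g(x) = α · (f(x))^β + γ for all x ∈ U, or there exist α ≠ 0 and γ ∈ ℝ with g(x) = α · ln(f(x)) + γ for all x ∈ U. -/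
theorem add_cont_lin (h : ℝ → ℝ) (hc : Continuous h) (hadd : ∀ s t, h (s + t) = h s + h t) (t : ℝ) :
    h t = h 1 * t := by
  let φ : ℝ →+ ℝ := AddMonoidHom.mk' h hadd
  have := map_real_smul φ hc t 1
  simp only [smul_eq_mul, mul_one] at this
  change h t = t * h 1 at this
  rw [this, mul_comm]

theorem all_shifts (G : ℝ → ℝ) (hG : Continuous G) (hinj : Function.Injective G) (L : ℝ) (hL : L ≠ 0)
    (h : ∀ n : ℕ, ∃ p q : ℝ, ∀ t, G (t + L * ((1 : ℝ) / 3) ^ n) = p * G t + q) (s t : ℝ) :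
    (G (t + s) - G s) * (G 1 - G 0) = (G (1 + s) - G s) * (G t - G 0) := by
  let D : AddSubgroup ℝ :=
    { carrier := {s | ∃ p q : ℝ, p ≠ 0 ∧ ∀ t, G (t + s) = p * G t + q}
      zero_mem' := ⟨1, 0, one_ne_zero, by simp⟩
      add_mem' := by
        rintro s s' ⟨p, q, hp, hpq⟩ ⟨p', q', hp', hpq'⟩
        refine ⟨p' * p, p' * q + q', mul_ne_zero hp' hp, fun t => ?_⟩
        rw [← add_assoc, hpq', hpq]; ring
      neg_mem' := by
        rintro s ⟨p, q, hp, hpq⟩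
        refine ⟨p⁻¹, -(p⁻¹ * q), inv_ne_zero hp, fun t => ?_⟩
        have := hpq (t + -s)
        rw [neg_add_cancel_right] at this
        rw [this]; field_simp; ring }
  have hmem : ∀ n : ℕ, L * ((1 : ℝ) / 3) ^ n ∈ D := by
    intro n
    obtain ⟨p, q, hpq⟩ := h n
    refine ⟨p, q, ?_, hpq⟩
    rintro rfl
    have h1 := hpq 1
    have h0 := hpq 0
    have := hinj (h1.trans (by rw [h0]; ring : _ = G (0 + L * ((1 : ℝ) / 3) ^ n)))
    simp at this
  have hdense : Dense (D : Set ℝ) := by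
    apply AddSubgroup.dense_of_not_isolated_zero
    intro ε hε
    have hLp : 0 < |L| := abs_pos.mpr hL
    obtain ⟨n, hn⟩ := exists_pow_lt_of_lt_one (div_pos hε hLp) (by norm_num : (1 : ℝ) / 3 < 1)
    refine ⟨|L| * ((1 : ℝ) / 3) ^ n, ?_, by positivity, ?_⟩
    · rcases abs_choice L with h' | h'
      · rw [h']; exact hmem n
      · rw [h', neg_mul]; exact D.neg_mem (hmem n)
    · rw [lt_div_iff₀ hLp] at hn; linarith
  have hclosed : IsClosed {s : ℝ | (G (t + s) - G s) * (G 1 - G 0) = (G (1 + s) - G s) * (G t - G 0)} :=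
    isClosed_eq (by fun_prop) (by fun_prop)
  have hsub : (D : Set ℝ) ⊆ {s : ℝ | (G (t + s) - G s) * (G 1 - G 0) = (G (1 + s) - G s) * (G t - G 0)} := by
    rintro s ⟨p, q, hp, hpq⟩
    have h0 := hpq 0
    rw [zero_add] at h0
    simp only [Set.mem_setOf_eq, hpq, h0]; ring
  exact hclosed.closure_subset_iff.mpr hsub (hdense s)

theorem core (G : ℝ → ℝ) (hG : Continuous G) (hinj : Function.Injective G) (L : ℝ) (hL : L ≠ 0)
    (h : ∀ n : ℕ, ∃ p q : ℝ, ∀ t, G (t + L * ((1 : ℝ) / 3) ^ n) = p * G t + q) :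
    (∃ α β γ : ℝ, α ≠ 0 ∧ β ≠ 0 ∧ ∀ t, G t = α * Real.exp (β * t) + γ) ∨
    (∃ α γ : ℝ, α ≠ 0 ∧ ∀ t, G t = α * t + γ) := by
  have key := all_shifts G hG hinj L hL h
  have hd : G 1 - G 0 ≠ 0 := sub_ne_zero.mpr (fun e => one_ne_zero (hinj e))
  obtain ⟨H, hH⟩ : ∃ H : ℝ → ℝ, H = fun t => G t - G 0 := ⟨_, rfl⟩
  obtain ⟨p, hp⟩ : ∃ p : ℝ → ℝ, p = fun s => (G (1 + s) - G s) / (G 1 - G 0) := ⟨_, rfl⟩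
  have hHc : Continuous H := by rw [hH]; fun_prop
  have hH1 : H 1 ≠ 0 := by rw [hH]; exact hd
  have hGH : ∀ t, G t = H t + G 0 := by intro t; rw [hH]; ring
  have feq : ∀ s t, H (t + s) = p s * H t + H s := by
    intro s t
    have := key s t
    simp only [hH, hp]
    field_simp
    linarith
  obtain ⟨c, hc⟩ : ∃ c, c = (p 1 - 1) / H 1 := ⟨_, rfl⟩
  have hpc : ∀ s, p s = 1 + c * H s := by
    intro s
    have h1 := feq s 1
    have h2 := feq 1 s
    rw [add_comm] at h2
    rw [hc]
    field_simp
    linarith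
  by_cases hc0 : c = 0
  · right
    refine ⟨H 1, G 0, hH1, fun t => ?_⟩
    rw [hGH, add_cont_lin H hHc (fun s t => ?_) t]
    rw [feq, hpc, hc0]; ring
  · left
    have hmul : ∀ s t, p (s + t) = p s * p t := by
      intro s t
      rw [hpc (s + t), feq, hpc s, hpc t]; ring
    have hp0 : p 0 = 1 := by
      rw [hpc, hH]; simp
    have hne : ∀ s, p s ≠ 0 := by
      intro s e
      have := hmul s (-s)
      rw [add_neg_cancel, hp0, e] at this
      simp at this
    have hpos : ∀ s, 0 < p s := by
      intro s
      have := hmul (s / 2) (s / 2)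
      rw [add_halves] at this
      rw [this]
      exact mul_self_pos.mpr (hne _)
    have hpcont : Continuous p := by
      have : p = fun s => 1 + c * H s := funext hpc
      rw [this]; fun_prop
    have hlin := add_cont_lin (fun s => Real.log (p s)) (hpcont.log hne)
      (fun s t => by simp only [hmul, Real.log_mul (hne s) (hne t)])
    have hexp : ∀ t, p t = Real.exp (Real.log (p 1) * t) := by
      intro t
      rw [← hlin t, Real.exp_log (hpos t)]
    refine ⟨1 / c, Real.log (p 1), G 0 - 1 / c, one_div_ne_zero hc0, ?_, fun t => ?_⟩
    · intro e
      have h1 := hexp 1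
      rw [e, zero_mul, Real.exp_zero, hpc] at h1
      have : c * H 1 = 0 := by linarith
      exact mul_ne_zero hc0 hH1 this
    · rw [← hexp, hpc, hGH]
      field_simp
      ring

theorem cont_of_mono (G : ℝ → ℝ) (hm : StrictMono G) (hr : (Set.range G).OrdConnected) :
    Continuous G := by
  haveI := hr
  exact continuous_subtype_val.comp (hm.orderIso G).continuous

theorem cont_of_anti (G : ℝ → ℝ) (hm : StrictAnti G) (hr : (Set.range G).OrdConnected) :
    Continuous G := by
  have h1 : StrictMono (fun t => G (-t)) := fun s t hst => hm (neg_lt_neg hst)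
  have h2 : Set.range (fun t => G (-t)) = Set.range G := (Equiv.neg ℝ).surjective.range_comp G
  have h3 := (cont_of_mono _ h1 (h2 ▸ hr)).comp continuous_neg
  simpa [Function.comp_def] using h3

/-- Case `a ≠ 1` of the main theorem: let `U` be a nonempty open interval, `f : U → ℝ`
continuous, strictly monotone, with `f '' U = (0, ∞)`, and `finv` its inverse. Let
`a > 0`, `a ≠ 1`. If `g : U → ℝ` is continuous, strictly monotone, and every map
`x ↦ f⁻¹(a^(3⁻ⁿ) f x)` satisfies `g ∘ η = pₙ g + qₙ`, then `g = α f^β + γ` or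
`g = α ln f + γ` on `U`. -/
theorem stmt_0 (U : Set ℝ) (hU_ne : U.Nonempty) (hU_open : IsOpen U) (hU_conn : U.OrdConnected)
    (f : ℝ → ℝ) (hf_cont : ContinuousOn f U)
    (hf_mono : StrictMonoOn f U ∨ StrictAntiOn f U)
    (hf_im : f '' U = Set.Ioi 0)
    (finv : ℝ → ℝ) (hfinv_left : ∀ x ∈ U, finv (f x) = x)
    (hfinv_right : ∀ y : ℝ, 0 < y → finv y ∈ U ∧ f (finv y) = y)
    (a : ℝ) (ha_pos : 0 < a) (ha_ne : a ≠ 1)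
    (g : ℝ → ℝ) (hg_cont : ContinuousOn g U)
    (hg_mono : StrictMonoOn g U ∨ StrictAntiOn g U)
    (hinv : ∀ n : ℕ, ∃ p q : ℝ, ∀ x ∈ U,
      g (finv (a ^ (((1 : ℝ) / 3) ^ n) * f x)) = p * g x + q) :
    (∃ α β γ : ℝ, α ≠ 0 ∧ β ≠ 0 ∧ ∀ x ∈ U, g x = α * (f x) ^ β + γ) ∨
    (∃ α γ : ℝ, α ≠ 0 ∧ ∀ x ∈ U, g x = α * Real.log (f x) + γ) := by
  obtain ⟨F, hF⟩ : ∃ F : ℝ → ℝ, F = fun t => finv (Real.exp t) := ⟨_, rfl⟩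
  have hFU : ∀ t, F t ∈ U := fun t => by rw [hF]; exact (hfinv_right _ (Real.exp_pos t)).1
  have hfF : ∀ t, f (F t) = Real.exp t := fun t => by
    rw [hF]; exact (hfinv_right _ (Real.exp_pos t)).2
  have hfpos : ∀ x ∈ U, 0 < f x := fun x hx => by
    have : f x ∈ f '' U := ⟨x, hx, rfl⟩
    rw [hf_im] at this; exact this
  have hFlog : ∀ x ∈ U, F (Real.log (f x)) = x := fun x hx => by
    simp only [hF]; rw [Real.exp_log (hfpos x hx), hfinv_left x hx]
  have hFmono : StrictMono F ∨ StrictAnti F := by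
    rcases hf_mono with hm | hm
    · left; intro s t hst
      rw [← hm.lt_iff_lt (hFU s) (hFU t), hfF, hfF]; exact Real.exp_lt_exp.mpr hst
    · right; intro s t hst
      rw [← hm.lt_iff_gt (hFU s) (hFU t), hfF, hfF]; exact Real.exp_lt_exp.mpr hst
  have hr : Set.range (fun t => g (F t)) = g '' U := by
    ext y; constructor
    · rintro ⟨t, rfl⟩; exact ⟨F t, hFU t, rfl⟩
    · rintro ⟨x, hx, rfl⟩; exact ⟨Real.log (f x), by simp only [hFlog x hx]⟩
  have hro : (Set.range (fun t => g (F t))).OrdConnected := by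
    rw [hr]
    exact (hU_conn.isPreconnected.image g hg_cont).ordConnected
  have hGmono : StrictMono (fun t => g (F t)) ∨ StrictAnti (fun t => g (F t)) := by
    rcases hg_mono with hm | hm <;> rcases hFmono with hm' | hm'
    · left; exact fun s t hst => hm (hFU _) (hFU _) (hm' hst)
    · right; exact fun s t hst => hm (hFU _) (hFU _) (hm' hst)
    · right; exact fun s t hst => hm (hFU _) (hFU _) (hm' hst)
    · left; exact fun s t hst => hm (hFU _) (hFU _) (hm' hst)
  have hGc : Continuous (fun t => g (F t)) :=
    hGmono.elim (fun h => cont_of_mono _ h hro) (fun h => cont_of_anti _ h hro)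
  have hGi : Function.Injective (fun t => g (F t)) :=
    hGmono.elim (fun h => h.injective) (fun h => h.injective)
  have hL : Real.log a ≠ 0 := Real.log_ne_zero_of_pos_of_ne_one ha_pos ha_ne
  have hshift : ∀ n : ℕ, ∃ p q : ℝ, ∀ t,
      g (F (t + Real.log a * ((1 : ℝ) / 3) ^ n)) = p * g (F t) + q := by
    intro n
    obtain ⟨p, q, hpq⟩ := hinv n
    refine ⟨p, q, fun t => ?_⟩
    rw [← hpq (F t) (hFU t), hfF, Real.rpow_def_of_pos ha_pos, ← Real.exp_add, hF]
    simp only [add_comm]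
  rcases core _ hGc hGi _ hL hshift with ⟨α, β, γ, hα, hβ, h⟩ | ⟨α, γ, hα, h⟩
  · left
    refine ⟨α, β, γ, hα, hβ, fun x hx => ?_⟩
    have := h (Real.log (f x))
    simp only [hFlog x hx] at this
    rw [this, Real.rpow_def_of_pos (hfpos x hx), mul_comm β]
  · right
    refine ⟨α, γ, hα, fun x hx => ?_⟩
    have := h (Real.log (f x))
    simp only [hFlog x hx] at this
    exact this
end

section
/- Let U ⊆ ℝ be a nonempty open interval and let f : U → ℝ be continuous and strictly monotone with f(U) = ℝ. Let b ≠ 0. Suppose g : U → ℝ is continuous and strictly monotone and that for every n ∈ ℕ there exist real numbers pₙ and qₙ such that g(f⁻¹(f(x) + b/3ⁿ)) = pₙ · g(x) + qₙ for all x ∈ U. Then either there exist α ≠ 0, β ≠ 0 and γ ∈ ℝ with g(x) = α · exp(β · f(x)) + γ for all x ∈ U, or there exist α ≠ 0 and γ ∈ ℝ with g(x) = α · f(x) + γ for all x ∈ U. -/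
theorem aux_linear (k : ℝ → ℝ) (hk : Continuous k) (hadd : ∀ x y, k (x + y) = k x + k y) (t : ℝ) :
    k t = k 1 * t := by
  let F : ℝ →+ ℝ := AddMonoidHom.mk' k hadd
  have := map_real_smul F hk t 1
  simp only [smul_eq_mul, mul_one] at this
  change k t = t * k 1 at this
  rw [this]; ring

theorem aux_finv (U : Set ℝ) (hU_open : IsOpen U) (finv : ℝ → ℝ) (hm : Monotone finv)
    (hr : Set.range finv = U) : Continuous finv := by
  rw [continuous_iff_continuousAt]
  intro a
  apply continuousAt_of_monotoneOn_of_image_mem_nhds (s := Set.univ) (hm.monotoneOn _)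
    Filter.univ_mem
  rw [Set.image_univ, hr]
  exact hU_open.mem_nhds (hr ▸ Set.mem_range_self a)

theorem aux_main (h : ℝ → ℝ) (hc : Continuous h) (hi : Function.Injective h) (b : ℝ) (hb : b ≠ 0)
    (H : ∀ n : ℕ, ∃ p q : ℝ, ∀ y, h (y + b / 3 ^ n) = p * h y + q) :
    (∃ α β γ : ℝ, α ≠ 0 ∧ β ≠ 0 ∧ ∀ y, h y = α * Real.exp (β * y) + γ) ∨
    (∃ α γ : ℝ, α ≠ 0 ∧ ∀ y, h y = α * y + γ) := by
  have hd : h 1 - h 0 ≠ 0 := by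
    intro h0
    exact one_ne_zero (hi (sub_eq_zero.mp h0))
  let S : AddSubgroup ℝ :=
    { carrier := {t | ∃ p q : ℝ, ∀ y, h (y + t) = p * h y + q}
      zero_mem' := ⟨1, 0, by simp⟩
      add_mem' := by
        rintro s t ⟨p, q, h1⟩ ⟨p', q', h2⟩
        refine ⟨p' * p, p' * q + q', fun y => ?_⟩
        rw [← add_assoc, h2, h1]; ring
      neg_mem' := by
        rintro t ⟨p, q, h1⟩
        have hp : p ≠ 0 := by
          rintro rfl
          have : (0:ℝ) + t = 1 + t := hi (by rw [h1, h1]; ring)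
          linarith
        refine ⟨p⁻¹, - p⁻¹ * q, fun y => ?_⟩
        have := h1 (y + -t)
        rw [neg_add_cancel_right] at this
        rw [this]; field_simp; ring }
  have hS : ∀ n : ℕ, |b| / 3 ^ n ∈ S := by
    intro n
    have : b / 3 ^ n ∈ S := H n
    rcases abs_choice b with h' | h' <;> rw [h']
    · exact this
    · rw [neg_div]; exact S.neg_mem this
  have hdense : Dense (S : Set ℝ) := by
    apply AddSubgroup.dense_of_not_isolated_zero
    intro ε hε
    have hbp : 0 < |b| := abs_pos.mpr hb
    obtain ⟨n, hn⟩ := pow_unbounded_of_one_lt (|b| / ε) (by norm_num : (1:ℝ) < 3)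
    refine ⟨_, hS n, by positivity, ?_⟩
    rw [div_lt_iff₀ hε] at hn
    rw [div_lt_iff₀ (by positivity)]
    linarith
  let T : Set ℝ := {t | ∀ y, (h (y + t) - h t) * (h 1 - h 0) = (h (1 + t) - h t) * (h y - h 0)}
  have hT : IsClosed T := by
    have : T = ⋂ y, {t | (h (y + t) - h t) * (h 1 - h 0) = (h (1 + t) - h t) * (h y - h 0)} := by
      ext t; simp [T]
    rw [this]
    exact isClosed_iInter fun y => isClosed_eq (by fun_prop) (by fun_prop)
  have hST : (S : Set ℝ) ⊆ T := by
    rintro t ⟨p, q, h1⟩ y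
    have h0 := h1 0
    rw [zero_add] at h0
    rw [h1, h1, h0]; ring
  have hall : ∀ t y, (h (y + t) - h t) * (h 1 - h 0) = (h (1 + t) - h t) * (h y - h 0) := by
    intro t
    exact hT.closure_subset_iff.mpr hST (hdense t)
  obtain ⟨d, hdd⟩ : ∃ d, d = h 1 - h 0 := ⟨_, rfl⟩
  rw [← hdd] at hd
  obtain ⟨k, hk⟩ : ∃ k : ℝ → ℝ, k = fun y => (h y - h 0) / d := ⟨_, rfl⟩
  have hhk : ∀ y, h y = d * k y + h 0 := by
    intro y; rw [hk]; field_simp; ring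
  have hkc : Continuous k := by rw [hk]; fun_prop
  have hk0 : k 0 = 0 := by simp [hk]
  have hk1 : k 1 = 1 := by rw [hk]; simp only [← hdd]; field_simp
  have hkk : ∀ t y, k (y + t) = (k (1 + t) - k t) * k y + k t := by
    intro t y
    have := hall t y
    rw [← hdd, hhk (y + t), hhk t, hhk (1 + t), hhk y] at this
    have h2 : d * d ≠ 0 := mul_ne_zero hd hd
    apply mul_left_cancel₀ h2
    linear_combination this
  obtain ⟨c, hcdef⟩ : ∃ c, c = k (1 + 1) - k 1 - 1 := ⟨_, rfl⟩
  have hp : ∀ t, k (1 + t) - k t = 1 + c * k t := by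
    intro t
    have h1 := hkk 1 t
    rw [add_comm t 1, hk1] at h1
    rw [hcdef, hk1]
    linear_combination h1
  have hkk' : ∀ t y, k (y + t) = (1 + c * k t) * k y + k t := by
    intro t y; rw [hkk, hp]
  by_cases hc0 : c = 0
  · right
    refine ⟨d, h 0, hd, fun y => ?_⟩
    rw [hhk, aux_linear k hkc (fun x y => by rw [hkk', hc0]; ring) y, hk1, one_mul]
  · left
    have hm : ∀ x y, 1 + c * k (x + y) = (1 + c * k x) * (1 + c * k y) := by
      intro x y; rw [hkk']; ring
    have hne : ∀ x, 1 + c * k x ≠ 0 := by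
      intro x hx
      have := hm x (-x)
      rw [add_neg_cancel, hk0, hx] at this
      simp at this
    have hpos : ∀ x, 0 < 1 + c * k x := by
      intro x
      have := hm (x/2) (x/2)
      rw [add_halves] at this
      rw [this]
      exact mul_self_pos.mpr (hne _)
    have hlin := aux_linear (fun x => Real.log (1 + c * k x))
      (Continuous.log (by fun_prop) hne)
      (fun x y => by simp only [hm]; exact Real.log_mul (hne x) (hne y))
    have hexp : ∀ y, 1 + c * k y = Real.exp (Real.log (1 + c * k 1) * y) := by
      intro y; rw [← hlin, Real.exp_log (hpos y)]
    refine ⟨d / c, Real.log (1 + c * k 1), h 0 - d / c, div_ne_zero hd hc0, ?_, fun y => ?_⟩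
    · intro h0
      have := hexp 1
      rw [h0, hk1] at this
      simp at this
      exact hc0 this
    · rw [← hexp, hhk]; field_simp; ring

/-- Case `a = 1` of the main theorem: let `U` be a nonempty open interval, `f : U → ℝ`
continuous, strictly monotone, with `f '' U = ℝ`, and `finv` its inverse. Let `b ≠ 0`.
If `g : U → ℝ` is continuous, strictly monotone, and every map `x ↦ f⁻¹(f x + b / 3ⁿ)`
satisfies `g ∘ η = pₙ g + qₙ`, then `g = α exp (β f) + γ` or `g = α f + γ` on `U`. -/
theorem stmt_1 (U : Set ℝ) (hU_ne : U.Nonempty) (hU_open : IsOpen U) (hU_conn : U.OrdConnected)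
    (f : ℝ → ℝ) (hf_cont : ContinuousOn f U)
    (hf_mono : StrictMonoOn f U ∨ StrictAntiOn f U)
    (hf_im : f '' U = Set.univ)
    (finv : ℝ → ℝ) (hfinv_left : ∀ x ∈ U, finv (f x) = x)
    (hfinv_right : ∀ y : ℝ, finv y ∈ U ∧ f (finv y) = y)
    (b : ℝ) (hb_ne : b ≠ 0)
    (g : ℝ → ℝ) (hg_cont : ContinuousOn g U)
    (hg_mono : StrictMonoOn g U ∨ StrictAntiOn g U)
    (hinv : ∀ n : ℕ, ∃ p q : ℝ, ∀ x ∈ U,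
      g (finv (f x + b / 3 ^ n)) = p * g x + q) :
    (∃ α β γ : ℝ, α ≠ 0 ∧ β ≠ 0 ∧ ∀ x ∈ U, g x = α * Real.exp (β * f x) + γ) ∨
    (∃ α γ : ℝ, α ≠ 0 ∧ ∀ x ∈ U, g x = α * f x + γ) := by
  have hg_inj : Set.InjOn g U := by
    rcases hg_mono with h | h
    · exact h.injOn
    · exact h.injOn
  have hrange : Set.range finv = U := by
    ext x
    constructor
    · rintro ⟨y, rfl⟩; exact (hfinv_right y).1
    · intro hx; exact ⟨f x, hfinv_left x hx⟩
  have hfc : Continuous finv := by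
    rcases hf_mono with h | h
    · apply aux_finv U hU_open finv _ hrange
      intro a c hac
      rw [← h.le_iff_le (hfinv_right a).1 (hfinv_right c).1, (hfinv_right a).2, (hfinv_right c).2]
      exact hac
    · have : Continuous (fun y => finv (-y)) := by
        apply aux_finv U hU_open
        · intro a c hac
          change finv (-a) ≤ finv (-c)
          rw [← h.le_iff_ge (hfinv_right _).1 (hfinv_right _).1, (hfinv_right _).2,
            (hfinv_right _).2]
          linarith
        · rw [← hrange]
          exact (Equiv.neg ℝ).surjective.range_comp finv
      simpa [Function.comp_def] using this.comp continuous_neg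
  have key := aux_main (fun y => g (finv y))
    (hg_cont.comp_continuous hfc fun y => (hfinv_right y).1)
    (fun a c hac => by
      have := hg_inj (hfinv_right a).1 (hfinv_right c).1 hac
      rw [← (hfinv_right a).2, this, (hfinv_right c).2]) b hb_ne
    (fun n => by
      obtain ⟨p, q, h⟩ := hinv n
      refine ⟨p, q, fun y => ?_⟩
      have := h _ (hfinv_right y).1
      rwa [(hfinv_right y).2] at this)
  rcases key with ⟨α, β, γ, h1, h2, h3⟩ | ⟨α, γ, h1, h3⟩
  · refine Or.inl ⟨α, β, γ, h1, h2, fun x hx => ?_⟩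
    rw [← h3 (f x), hfinv_left x hx]
  · refine Or.inr ⟨α, γ, h1, fun x hx => ?_⟩
    rw [← h3 (f x), hfinv_left x hx]
end

section
/- Let U ⊆ ℝ be a nonempty interval and let g : U → ℝ be continuous and strictly monotone with g(x) > 0 for all x ∈ U. Fix n ≥ 2, a vector v : Fin n → U that is not constant, and weights w : Fin n → ℝ with wᵢ > 0 for all i and ∑ᵢ wᵢ = 1. For each β ∈ ℝ let m_β : (0,∞) → ℝ be defined by m_β(x) = x^β if β ≠ 0 and m_0(x) = ln x. Then for each β ∈ ℝ there is a unique t(β) ∈ U with m_β(g(t(β))) = ∑ᵢ wᵢ · m_β(g(vᵢ)), and the map β ↦ t(β) is injective with range exactly the open interval (minᵢ vᵢ, maxᵢ vᵢ). -/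
noncomputable def psi (y : ℝ) : ℝ := dslope Real.exp 0 y

lemma psi_zero : psi 0 = 1 := by simp [psi, dslope_same]

lemma psi_mul (y : ℝ) : y * psi y = Real.exp y - 1 := by
  have := sub_smul_dslope Real.exp 0 y
  simpa [psi] using this

lemma psi_cont : Continuous psi := by
  have h : ContinuousOn (dslope Real.exp 0) Set.univ :=
    (continuousOn_dslope (by simp)).2 ⟨Real.continuous_exp.continuousOn, Real.differentiableAt_exp⟩
  exact continuousOn_univ.1 h

lemma psi_ne (y : ℝ) (hy : y ≠ 0) : psi y = (Real.exp y - 1) / y := by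
  rw [eq_div_iff hy, mul_comm, psi_mul]

lemma psi_mono : StrictMono psi := by
  intro y z hyz
  by_cases hy : y = 0
  · subst hy
    rw [psi_zero, psi_ne z hyz.ne', lt_div_iff₀ hyz]
    linarith [Real.add_one_lt_exp hyz.ne']
  by_cases hz : z = 0
  · subst hz
    rw [psi_zero, psi_ne y hy, div_lt_iff_of_neg hyz]
    linarith [Real.add_one_lt_exp hy]
  have := strictConvexOn_exp.secant_strict_mono (Set.mem_univ 0) (Set.mem_univ y) (Set.mem_univ z)
    hy hz hyz
  rw [psi_ne y hy, psi_ne z hz]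
  simpa using this

noncomputable def phi (β x : ℝ) : ℝ := x * psi (β * x)

lemma mul_phi (β x : ℝ) : β * phi β x = Real.exp (β * x) - 1 := by
  rw [← psi_mul, phi]; ring

lemma phi_zero_left (x : ℝ) : phi 0 x = x := by simp [phi, psi_zero]

lemma phi_zero_right (β : ℝ) : phi β 0 = 0 := by simp [phi]

lemma phi_neg (β x : ℝ) : phi (-β) (-x) = - phi β x := by simp [phi]

lemma phi_mono_left {x : ℝ} (hx : x ≠ 0) : StrictMono (fun β => phi β x) := by
  intro b c hbc
  simp only [phi]
  rcases lt_or_gt_of_ne hx with h | h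
  · exact mul_lt_mul_of_neg_left (psi_mono (by nlinarith)) h
  · exact mul_lt_mul_of_pos_left (psi_mono (by nlinarith)) h

lemma phi_mono_right (β : ℝ) : StrictMono (phi β) := by
  intro x y hxy
  have hx := mul_phi β x
  have hy := mul_phi β y
  rcases lt_trichotomy β 0 with h | h | h
  · have : Real.exp (β * y) < Real.exp (β * x) := Real.exp_lt_exp.2 (by nlinarith)
    by_contra hc
    nlinarith
  · subst h; simpa [phi_zero_left] using hxy
  · have : Real.exp (β * x) < Real.exp (β * y) := Real.exp_lt_exp.2 (by nlinarith)
    by_contra hc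
    nlinarith

lemma phi_cont_left (x : ℝ) : Continuous (fun β => phi β x) := by
  unfold phi
  exact continuous_const.mul (psi_cont.comp (by fun_prop))

lemma phi_cont_right (β : ℝ) : Continuous (phi β) := by
  unfold phi
  exact continuous_id.mul (psi_cont.comp (by fun_prop))

section
variable {n : ℕ} (w : Fin n → ℝ)

lemma exists_pos (hw : ∀ i, 0 < w i) (hs : ∑ i, w i = 1) (x : Fin n → ℝ) (j : Fin n)
    (hj : 0 < x j) : ∃ β, 0 < ∑ i, w i * phi β (x i) := by
  have hp : 0 < w j * x j := mul_pos (hw j) hj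
  set b := 2 / (w j * x j) with hb
  have hb0 : 0 < b := by positivity
  refine ⟨b, ?_⟩
  have key : ∀ i, w i * (-(1 / b) + if i = j then x j else 0) ≤ w i * phi b (x i) := by
    intro i
    refine mul_le_mul_of_nonneg_left ?_ (hw i).le
    split_ifs with h
    · subst h
      have h1 : phi 0 (x i) < phi b (x i) := phi_mono_left hj.ne' hb0
      rw [phi_zero_left] at h1
      have : 0 < 1 / b := by positivity
      linarith
    · have h1 := mul_phi b (x i)
      have h2 := Real.exp_pos (b * x i)
      have : phi b (x i) = (Real.exp (b * x i) - 1) / b := by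
        rw [eq_div_iff hb0.ne', mul_comm, h1]
      rw [this, add_zero, ← neg_div]
      gcongr
      linarith
  have h2 := Finset.sum_le_sum (fun i (_ : i ∈ Finset.univ) => key i)
  have h3 : ∑ i, w i * (-(1 / b) + if i = j then x j else 0) = -(1 / b) + w j * x j := by
    simp_rw [mul_add, Finset.sum_add_distrib, ← Finset.sum_mul, hs]
    simp
  have h4 : 1 / b = w j * x j / 2 := by rw [hb]; simp
  rw [h3, h4] at h2
  linarith

lemma exists_zero (hw : ∀ i, 0 < w i) (hs : ∑ i, w i = 1) (x : Fin n → ℝ) (i j : Fin n)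
    (hi : x i < 0) (hj : 0 < x j) : ∃ β, ∑ i, w i * phi β (x i) = 0 := by
  obtain ⟨b, hb⟩ := exists_pos w hw hs x j hj
  obtain ⟨c, hc⟩ := exists_pos w hw hs (fun k => - x k) i (by simpa using hi)
  have hc' : ∑ i, w i * phi (-c) (x i) < 0 := by
    have : ∀ k, phi c (- x k) = - phi (-c) (x k) := fun k => by
      rw [← phi_neg, neg_neg]
    simp only [this, mul_neg, Finset.sum_neg_distrib] at hc
    linarith
  have hcont : Continuous (fun β => ∑ i, w i * phi β (x i)) :=
    continuous_finsetSum _ fun k _ => continuous_const.mul (phi_cont_left (x k))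
  exact mem_range_of_exists_le_of_exists_ge hcont ⟨_, hc'.le⟩ ⟨_, hb.le⟩

lemma phi_sign_nonneg {β x : ℝ} (h : 0 ≤ x) : 0 ≤ phi β x := by
  simpa [phi_zero_right] using (phi_mono_right β).monotone h

lemma phi_sign_nonpos {β x : ℝ} (h : x ≤ 0) : phi β x ≤ 0 := by
  simpa [phi_zero_right] using (phi_mono_right β).monotone h

lemma phi_eq_zero {β x : ℝ} (h : phi β x = 0) : x = 0 :=
  (phi_mono_right β).injective (by simpa [phi_zero_right] using h)

lemma exists_pos_of_sum (hw : ∀ i, 0 < w i) (x : Fin n → ℝ) (β : ℝ)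
    (h0 : ∑ i, w i * phi β (x i) = 0) (hx : ∃ i, x i ≠ 0) : ∃ i, 0 < x i := by
  by_contra! hc
  obtain ⟨i, hi⟩ := hx
  have := (Finset.sum_eq_zero_iff_of_nonpos (fun k _ =>
    mul_nonpos_of_nonneg_of_nonpos (hw k).le (phi_sign_nonpos (hc k)))).1 h0 i (Finset.mem_univ i)
  rcases mul_eq_zero.1 this with h | h
  · exact (hw i).ne' h
  · exact hi (phi_eq_zero h)

lemma exists_neg_of_sum (hw : ∀ i, 0 < w i) (x : Fin n → ℝ) (β : ℝ)
    (h0 : ∑ i, w i * phi β (x i) = 0) (hx : ∃ i, x i ≠ 0) : ∃ i, x i < 0 := by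
  by_contra! hc
  obtain ⟨i, hi⟩ := hx
  have := (Finset.sum_eq_zero_iff_of_nonneg (fun k _ =>
    mul_nonneg (hw k).le (phi_sign_nonneg (hc k)))).1 h0 i (Finset.mem_univ i)
  rcases mul_eq_zero.1 this with h | h
  · exact (hw i).ne' h
  · exact hi (phi_eq_zero h)

lemma exists_c (hw : ∀ i, 0 < w i) (a : Fin n → ℝ) (hn : 2 ≤ n) (β : ℝ) :
    ∃ c, ∑ i, w i * phi β (a i - c) = 0 := by
  haveI : Nonempty (Fin n) := ⟨⟨0, by omega⟩⟩
  obtain ⟨i, hi⟩ := Finite.exists_min a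
  obtain ⟨j, hj⟩ := Finite.exists_max a
  have hcont : Continuous (fun c => ∑ i, w i * phi β (a i - c)) :=
    continuous_finsetSum _ fun k _ => continuous_const.mul
      ((phi_cont_right β).comp (by fun_prop))
  refine mem_range_of_exists_le_of_exists_ge hcont ⟨a j, ?_⟩ ⟨a i, ?_⟩
  · exact Finset.sum_nonpos fun k _ => mul_nonpos_of_nonneg_of_nonpos (hw k).le
      (phi_sign_nonpos (by linarith [hj k]))
  · exact Finset.sum_nonneg fun k _ => mul_nonneg (hw k).le
      (phi_sign_nonneg (by linarith [hi k]))

lemma c_unique (hw : ∀ i, 0 < w i) (a : Fin n → ℝ) (hn : 2 ≤ n) (β : ℝ) {c d : ℝ}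
    (hc : ∑ i, w i * phi β (a i - c) = 0) (hd : ∑ i, w i * phi β (a i - d) = 0) : c = d := by
  haveI : Nonempty (Fin n) := ⟨⟨0, by omega⟩⟩
  have anti : StrictAnti (fun c => ∑ i, w i * phi β (a i - c)) := by
    intro p q hpq
    refine Finset.sum_lt_sum_of_nonempty Finset.univ_nonempty fun k _ => ?_
    exact mul_lt_mul_of_pos_left (phi_mono_right β (by linarith)) (hw k)
  exact anti.injective (hc.trans hd.symm)

lemma beta_unique (hw : ∀ i, 0 < w i) (x : Fin n → ℝ) (hx : ∃ i, x i ≠ 0) {b c : ℝ}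
    (hb : ∑ i, w i * phi b (x i) = 0) (hc : ∑ i, w i * phi c (x i) = 0) : b = c := by
  have mono : StrictMono (fun c => ∑ i, w i * phi c (x i)) := by
    intro p q hpq
    obtain ⟨i, hi⟩ := hx
    refine Finset.sum_lt_sum (fun k _ => ?_) ⟨i, Finset.mem_univ i, ?_⟩
    · by_cases hk : x k = 0
      · simp [hk, phi_zero_right]
      · exact mul_le_mul_of_nonneg_left (phi_mono_left hk hpq).le (hw k).le
    · exact mul_lt_mul_of_pos_left (phi_mono_left hi hpq) (hw i)
  exact mono.injective (hb.trans hc.symm)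

lemma mean_iff (hs : ∑ i, w i = 1) (y : Fin n → ℝ) (hy : ∀ i, 0 < y i) {z : ℝ} (hz : 0 < z)
    (m : ℝ → ℝ → ℝ)
    (hm : ∀ β x : ℝ, m β x = if β = 0 then Real.log x else x ^ β) (β : ℝ) :
    m β z = ∑ i, w i * m β (y i) ↔
      ∑ i, w i * phi β (Real.log (y i) - Real.log z) = 0 := by
  by_cases hβ : β = 0
  · subst hβ
    simp only [hm, if_true, phi_zero_left, mul_sub, Finset.sum_sub_distrib, ← Finset.sum_mul, hs]
    constructor <;> intro h <;> linarith
  · simp only [hm, if_neg hβ]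
    have hzb : 0 < z ^ β := Real.rpow_pos_of_pos hz β
    have e : ∀ i, w i * phi β (Real.log (y i) - Real.log z)
        = (w i * y i ^ β - w i * z ^ β) * (1 / (z ^ β * β)) := by
      intro i
      have h1 := mul_phi β (Real.log (y i) - Real.log z)
      have h2 : Real.exp (β * (Real.log (y i) - Real.log z)) = y i ^ β / z ^ β := by
        rw [Real.rpow_def_of_pos (hy i), Real.rpow_def_of_pos hz, ← Real.exp_sub]
        ring_nf
      rw [h2] at h1
      have h3 : phi β (Real.log (y i) - Real.log z) = (y i ^ β / z ^ β - 1) / β := by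
        rw [eq_div_iff hβ, mul_comm, h1]
      rw [h3]
      field_simp
    simp only [e, ← Finset.sum_mul, Finset.sum_sub_distrib, hs, one_mul]
    have : 1 / (z ^ β * β) ≠ 0 := by
      apply one_div_ne_zero; exact mul_ne_zero hzb.ne' hβ
    rw [mul_eq_zero, or_iff_left this, sub_eq_zero, eq_comm]

end

/-- Lemma: for a continuous strictly monotone positive `g` on a nonempty interval `U`,
the family of quasi-arithmetic means generated by `{g^β : β ≠ 0} ∪ {ln g}` is a scale on
`U`: for each non-constant `v : Fin n → U` and fixed positive weights `w` summing to `1`,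
the mean `t β` exists, is unique, and `β ↦ t β` is injective with range `(min v, max v)`. -/
theorem stmt_2 (U : Set ℝ) (hU_ne : U.Nonempty) (hU_conn : U.OrdConnected)
    (g : ℝ → ℝ) (hg_cont : ContinuousOn g U)
    (hg_mono : StrictMonoOn g U ∨ StrictAntiOn g U)
    (hg_pos : ∀ x ∈ U, 0 < g x)
    (n : ℕ) (hn : 2 ≤ n)
    (v : Fin n → ℝ) (hv_mem : ∀ i, v i ∈ U) (hv_nc : ∃ i j, v i ≠ v j)
    (w : Fin n → ℝ) (hw_pos : ∀ i, 0 < w i) (hw_sum : ∑ i, w i = 1)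
    (m : ℝ → ℝ → ℝ)
    (hm : ∀ β x : ℝ, m β x = if β = 0 then Real.log x else x ^ β) :
    ∃ t : ℝ → ℝ,
      (∀ β : ℝ, t β ∈ U ∧ m β (g (t β)) = ∑ i, w i * m β (g (v i)) ∧
        (∀ s ∈ U, m β (g s) = ∑ i, w i * m β (g (v i)) → s = t β)) ∧
      Function.Injective t ∧
      Set.range t = Set.Ioo (⨅ i, v i) (⨆ i, v i) := by
  haveI : Nonempty (Fin n) := ⟨⟨0, by omega⟩⟩
  set L : ℝ → ℝ := fun x => Real.log (g x) with hL
  have hLc : ContinuousOn L U := hg_cont.log fun x hx => (hg_pos x hx).ne'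
  have hLm : StrictMonoOn L U ∨ StrictAntiOn L U := by
    rcases hg_mono with h | h
    · exact Or.inl fun x hx y hy hxy => Real.log_lt_log (hg_pos x hx) (h hx hy hxy)
    · exact Or.inr fun x hx y hy hxy => Real.log_lt_log (hg_pos y hy) (h hx hy hxy)
  have hLi : Set.InjOn L U := by
    rcases hLm with h | h
    · exact h.injOn
    · exact h.injOn
  have hiff : ∀ β, ∀ s ∈ U, (m β (g s) = ∑ i, w i * m β (g (v i)) ↔
      ∑ i, w i * phi β (L (v i) - L s) = 0) := fun β s hsU =>
    mean_iff w hw_sum (fun i => g (v i)) (fun i => hg_pos _ (hv_mem i)) (hg_pos s hsU) m hm β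
  have hnc : ∀ c, ∃ i, L (v i) - c ≠ 0 := by
    intro c
    by_contra! hc
    obtain ⟨i, j, hij⟩ := hv_nc
    exact hij (hLi (hv_mem i) (hv_mem j) (by linarith [hc i, hc j]))
  have hIoo : ∀ s, s ∈ Set.Ioo (⨅ i, v i) (⨆ i, v i) ↔ (∃ i, v i < s) ∧ ∃ j, s < v j := by
    intro s
    rw [Set.mem_Ioo, ciInf_lt_iff (Set.finite_range v).bddBelow,
      lt_ciSup_iff (Set.finite_range v).bddAbove]
  have hbetw : ∀ s ∈ U, (((∃ i, v i < s) ∧ ∃ j, s < v j) ↔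
      ((∃ i, L (v i) - L s < 0) ∧ ∃ j, 0 < L (v j) - L s)) := by
    intro s hsU
    simp only [sub_neg, sub_pos]
    rcases hLm with h | h
    · simp only [h.lt_iff_lt (hv_mem _) hsU, h.lt_iff_lt hsU (hv_mem _)]
    · simp only [h.lt_iff_gt (hv_mem _) hsU, h.lt_iff_gt hsU (hv_mem _)]
      exact and_comm
  have hex : ∀ β, ∃ s ∈ U, ∑ i, w i * phi β (L (v i) - L s) = 0 := by
    intro β
    obtain ⟨c, hc⟩ := exists_c w hw_pos (fun i => L (v i)) hn β
    obtain ⟨i, hi⟩ := exists_neg_of_sum w hw_pos _ β hc (hnc c)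
    obtain ⟨j, hj⟩ := exists_pos_of_sum w hw_pos _ β hc (hnc c)
    have hsub : Set.uIcc (v i) (v j) ⊆ U := hU_conn.uIcc_subset (hv_mem i) (hv_mem j)
    obtain ⟨s, hs, rfl⟩ := intermediate_value_uIcc (hLc.mono hsub)
      (Set.Icc_subset_uIcc (⟨by linarith, by linarith⟩ : c ∈ Set.Icc (L (v i)) (L (v j))))
    exact ⟨s, hsub hs, hc⟩
  choose t htU ht using hex
  have hun : ∀ β, ∀ s ∈ U, ∑ i, w i * phi β (L (v i) - L s) = 0 → s = t β := fun β s hsU h =>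
    hLi hsU (htU β) (c_unique w hw_pos (fun i => L (v i)) hn β h (ht β))
  refine ⟨t, fun β => ⟨htU β, (hiff β _ (htU β)).2 (ht β), fun s hsU h =>
    hun β s hsU ((hiff β s hsU).1 h)⟩, ?_, ?_⟩
  · intro b c hbc
    have h1 := ht b
    rw [hbc] at h1
    exact beta_unique w hw_pos _ (hnc _) h1 (ht c)
  · ext s
    rw [hIoo]
    constructor
    · rintro ⟨β, rfl⟩
      exact (hbetw _ (htU β)).2 ⟨exists_neg_of_sum w hw_pos _ β (ht β) (hnc _),
        exists_pos_of_sum w hw_pos _ β (ht β) (hnc _)⟩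
    · intro h
      have hsU : s ∈ U := by
        obtain ⟨⟨i, hi⟩, ⟨j, hj⟩⟩ := h
        exact hU_conn.out (hv_mem i) (hv_mem j) ⟨hi.le, hj.le⟩
      obtain ⟨⟨i, hi⟩, ⟨j, hj⟩⟩ := (hbetw s hsU).1 h
      obtain ⟨β, hβ⟩ := exists_zero w hw_pos hw_sum (fun i => L (v i) - L s) i j hi hj
      exact ⟨β, (hun β s hsU hβ).symm⟩
end

section
/- Fix n ≥ 2, a vector v : Fin n → (0, ∞) that is not constant, and weights w : Fin n → ℝ with wᵢ > 0 for all i and ∑ᵢ wᵢ = 1. Define the weighted power mean P : ℝ → ℝ by P(t) = (∑ᵢ wᵢ · vᵢ^t)^(1/t) for t ≠ 0 and P(0) = ∏ᵢ vᵢ^(wᵢ). Then P is injective and its range is exactly the open interval (minᵢ vᵢ, maxᵢ vᵢ). -/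
lemma pm_strictConvex {n : ℕ} (w l : Fin n → ℝ) (hw : ∀ i, 0 < w i) (hl : ∃ i, l i ≠ 0) :
    StrictConvexOn ℝ Set.univ (fun t : ℝ => ∑ i, w i * Real.exp (t * l i)) := by
  refine ⟨convex_univ, ?_⟩
  intro x _ y _ hxy a b ha hb hab
  simp only [smul_eq_mul, Finset.mul_sum]
  rw [← Finset.sum_add_distrib]
  have key : ∀ i, (a * x + b * y) * l i = a * (x * l i) + b * (y * l i) := fun i => by ring
  obtain ⟨j, hj⟩ := hl
  refine Finset.sum_lt_sum (fun i _ => ?_) ⟨j, Finset.mem_univ _, ?_⟩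
  · have h := convexOn_exp.2 (Set.mem_univ (x * l i)) (Set.mem_univ (y * l i)) ha.le hb.le hab
    simp only [smul_eq_mul] at h
    rw [key]
    nlinarith [mul_le_mul_of_nonneg_left h (hw i).le]
  · have hne : x * l j ≠ y * l j := fun h => hxy (mul_right_cancel₀ hj h)
    have h := strictConvexOn_exp.2 (Set.mem_univ (x * l j)) (Set.mem_univ (y * l j)) hne ha hb hab
    simp only [smul_eq_mul] at h
    rw [key]
    nlinarith [mul_lt_mul_of_pos_left h (hw j)]

lemma pm_three {F : ℝ → ℝ} (hF : StrictConvexOn ℝ Set.univ F) {a b c k : ℝ} (hab : a < b)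
    (hbc : b < c) (ha : F a = k) (hb : F b = k) (hc : F c = k) : False := by
  have h := hF.slope_strict_mono_adjacent (Set.mem_univ a) (Set.mem_univ c) hab hbc
  simp [ha, hb, hc] at h

theorem stmt_3 (n : ℕ) (hn : 2 ≤ n)
    (v : Fin n → ℝ) (hv_pos : ∀ i, 0 < v i) (hv_nc : ∃ i j, v i ≠ v j)
    (w : Fin n → ℝ) (hw_pos : ∀ i, 0 < w i) (hw_sum : ∑ i, w i = 1)
    (P : ℝ → ℝ)
    (hP : ∀ t : ℝ, P t = if t = 0 then ∏ i, (v i) ^ (w i)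
      else (∑ i, w i * (v i) ^ t) ^ (1 / t)) :
    Function.Injective P ∧ Set.range P = Set.Ioo (⨅ i, v i) (⨆ i, v i) := by
  have : Nonempty (Fin n) := ⟨⟨0, by omega⟩⟩
  have hP0 : P 0 = ∏ i, (v i) ^ (w i) := by simp [hP]
  have hPt : ∀ t, t ≠ 0 → P t = (∑ i, w i * (v i) ^ t) ^ (1 / t) := fun t ht => by simp [hP, ht]
  have hSpos : ∀ t : ℝ, 0 < ∑ i, w i * (v i) ^ t := fun t =>
    Finset.sum_pos (fun i _ => mul_pos (hw_pos i) (Real.rpow_pos_of_pos (hv_pos i) t))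
      Finset.univ_nonempty
  have hPpos : ∀ t, 0 < P t := by
    intro t
    by_cases ht : t = 0
    · rw [ht, hP0]
      exact Finset.prod_pos fun i _ => Real.rpow_pos_of_pos (hv_pos i) _
    · rw [hPt t ht]; exact Real.rpow_pos_of_pos (hSpos t) _
  have hpow : ∀ t, t ≠ 0 → ∑ i, w i * (v i) ^ t = P t ^ t := by
    intro t ht
    rw [hPt t ht, ← Real.rpow_mul (hSpos t).le, one_div, inv_mul_cancel₀ ht, Real.rpow_one]
  -- strict AM-GM
  have hamgm : ∀ t : ℝ, t ≠ 0 → P 0 ^ t < ∑ i, w i * (v i) ^ t := by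
    intro t ht
    have h := (Real.geom_mean_lt_arith_mean_weighted_iff_of_pos Finset.univ w
      (fun i => (v i) ^ t) (fun i _ => hw_pos i) hw_sum
      (fun i _ => (Real.rpow_pos_of_pos (hv_pos i) t).le)).2 (by
        obtain ⟨i, j, hij⟩ := hv_nc
        refine ⟨i, Finset.mem_univ _, j, Finset.mem_univ _, fun h => hij ?_⟩
        exact (Real.rpow_left_inj (hv_pos i).le (hv_pos j).le ht).1 h)
    rw [hP0, ← Real.finsetProd_rpow _ _ (fun i _ => (Real.rpow_pos_of_pos (hv_pos i) _).le)]
    convert h using 2 with i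
    rw [← Real.rpow_mul (hv_pos i).le, ← Real.rpow_mul (hv_pos i).le, mul_comm]
  have hne0 : ∀ t, t ≠ 0 → P t ≠ P 0 := by
    intro t ht h
    have := hamgm t ht
    rw [hpow t ht, h] at this
    exact lt_irrefl _ this
  have hinj : Function.Injective P := by
    intro s t hst
    by_contra hne
    by_cases hs : s = 0
    · subst hs; exact hne0 t (Ne.symm hne) hst.symm
    by_cases ht : t = 0
    · subst ht; exact hne0 s hne hst
    have hF := pm_strictConvex w (fun i => Real.log (v i) - Real.log (P s)) hw_pos (by
      obtain ⟨i, j, hij⟩ := hv_nc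
      by_contra! h
      exact hij (Real.log_injOn_pos (hv_pos i) (hv_pos j) (by linarith [h i, h j])))
    set F := fun t : ℝ => ∑ i, w i * Real.exp (t * (Real.log (v i) - Real.log (P s))) with hFdef
    have h0 : F 0 = 1 := by simp [hFdef, hw_sum]
    have h1 : ∀ r, r ≠ 0 → P r = P s → F r = 1 := by
      intro r hr hrs
      have e : F r = (∑ i, w i * (v i) ^ r) / P s ^ r := by
        rw [hFdef, Finset.sum_div]
        refine Finset.sum_congr rfl fun i _ => ?_
        rw [Real.rpow_def_of_pos (hv_pos i), Real.rpow_def_of_pos (hPpos s), mul_div_assoc,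
          ← Real.exp_sub]
        ring_nf
      rw [e, hpow r hr, hrs, div_self (Real.rpow_pos_of_pos (hPpos s) r).ne']
    have hs1 := h1 s hs rfl
    have ht1 := h1 t ht hst.symm
    rcases lt_or_gt_of_ne hs with a | a <;> rcases lt_or_gt_of_ne ht with b | b <;>
      rcases lt_or_gt_of_ne hne with c | c
    · exact pm_three hF c b hs1 ht1 h0
    · exact pm_three hF c a ht1 hs1 h0
    · exact pm_three hF a b hs1 h0 ht1
    · linarith
    · linarith
    · exact pm_three hF b a ht1 h0 hs1
    · exact pm_three hF a c h0 hs1 ht1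
    · exact pm_three hF b c h0 ht1 hs1
  -- continuity
  have hcont : Continuous P := by
    set L : ℝ → ℝ := fun t => Real.log (∑ i, w i * (v i) ^ t) with hL
    have hS : ∀ t, HasDerivAt (fun t : ℝ => ∑ i, w i * (v i) ^ t)
        (∑ i, w i * ((v i) ^ t * Real.log (v i))) t := by
      intro t
      refine HasDerivAt.fun_sum fun i _ => ?_
      exact (Real.hasStrictDerivAt_const_rpow (hv_pos i) t).hasDerivAt.const_mul (w i)
    have hLd : ∀ t, HasDerivAt L
        ((∑ i, w i * ((v i) ^ t * Real.log (v i))) / ∑ i, w i * (v i) ^ t) t :=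
      fun t => (hS t).log (hSpos t).ne'
    have hD : Continuous (dslope L 0) := by
      rw [continuous_iff_continuousAt]
      intro t
      by_cases ht : t = 0
      · subst ht; exact continuousAt_dslope_same.2 (hLd 0).differentiableAt
      · exact (continuousAt_dslope_of_ne ht).2 (hLd t).continuousAt
    have hE : P = fun t => Real.exp (dslope L 0 t) := by
      funext t
      by_cases ht : t = 0
      · subst ht
        rw [dslope_same, (hLd 0).deriv, hP0]
        simp only [Real.rpow_zero, one_mul, mul_one, hw_sum, div_one, Real.exp_sum]
        refine Finset.prod_congr rfl fun i _ => ?_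
        rw [Real.rpow_def_of_pos (hv_pos i), mul_comm]
      · rw [dslope_of_ne _ ht, hPt t ht, Real.rpow_def_of_pos (hSpos t), slope_def_field]
        simp [hL, hw_sum, div_eq_mul_inv]
    rw [hE]
    exact Real.continuous_exp.comp hD
  have hmono : StrictMono P := by
    rcases hcont.strictMono_of_inj hinj with h | h
    · exact h
    · exfalso
      have h1 := h (zero_lt_one)
      have h2 := hamgm 1 one_ne_zero
      rw [hpow 1 one_ne_zero, Real.rpow_one, Real.rpow_one] at h2
      linarith
  have hbddA : BddAbove (Set.range v) := (Set.finite_range v).bddAbove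
  have hbddB : BddBelow (Set.range v) := (Set.finite_range v).bddBelow
  obtain ⟨iM, hM⟩ := exists_eq_ciSup_of_finite (f := v)
  obtain ⟨im, hm⟩ := exists_eq_ciInf_of_finite (f := v)
  have hleM : ∀ i, v i ≤ v iM := fun i => hM ▸ le_ciSup hbddA i
  have hlem : ∀ i, v im ≤ v i := fun i => hm ▸ ciInf_le hbddB i
  rw [← hM, ← hm]
  have hup : ∀ t, 0 < t → P t ≤ v iM := by
    intro t ht
    rw [← Real.rpow_le_rpow_iff (hPpos t).le (hv_pos iM).le ht, ← hpow t ht.ne']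
    calc _ ≤ ∑ i, w i * v iM ^ t := Finset.sum_le_sum fun i _ =>
          mul_le_mul_of_nonneg_left (Real.rpow_le_rpow (hv_pos i).le (hleM i) ht.le) (hw_pos i).le
      _ = _ := by rw [← Finset.sum_mul, hw_sum, one_mul]
  have hlo : ∀ t, t < 0 → v im ≤ P t := by
    intro t ht
    rw [← Real.rpow_le_rpow_iff_of_neg (hPpos t) (hv_pos im) ht, ← hpow t ht.ne]
    calc _ ≤ ∑ i, w i * v im ^ t := Finset.sum_le_sum fun i _ =>
          mul_le_mul_of_nonneg_left (Real.rpow_le_rpow_of_nonpos (hv_pos im) (hlem i) ht.le)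
            (hw_pos i).le
      _ = _ := by rw [← Finset.sum_mul, hw_sum, one_mul]
  have hterm : ∀ (j : Fin n) (t : ℝ), w j * v j ^ t ≤ ∑ i, w i * v i ^ t := fun j t =>
    Finset.single_le_sum (f := fun i => w i * v i ^ t)
      (fun i _ => (mul_pos (hw_pos i) (Real.rpow_pos_of_pos (hv_pos i) t)).le) (Finset.mem_univ j)
  have hmulpow : ∀ (j : Fin n) (t : ℝ), t ≠ 0 →
      (w j ^ (1 / t) * v j) ^ t = w j * v j ^ t := by
    intro j t ht
    rw [Real.mul_rpow (Real.rpow_pos_of_pos (hw_pos j) _).le (hv_pos j).le,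
      ← Real.rpow_mul (hw_pos j).le, one_div, inv_mul_cancel₀ ht, Real.rpow_one]
  have hbpos : ∀ (j : Fin n) (t : ℝ), 0 < w j ^ (1 / t) * v j := fun j t =>
    mul_pos (Real.rpow_pos_of_pos (hw_pos j) _) (hv_pos j)
  have htend : ∀ (j : Fin n) (l : Filter ℝ), Filter.Tendsto (fun t : ℝ => t⁻¹) l (nhds 0) →
      Filter.Tendsto (fun t : ℝ => w j ^ (1 / t) * v j) l (nhds (v j)) := by
    intro j l hl
    have h := ((Real.continuousAt_const_rpow (hw_pos j).ne' (b := 0)).tendsto.comp hl).mul_const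
      (v j)
    simpa [Function.comp_def] using h
  refine ⟨hinj, Set.Subset.antisymm ?_ ?_⟩
  · rintro _ ⟨t, rfl⟩
    constructor
    · exact (hlo (-|t| - 1) (by linarith [abs_nonneg t])).trans_lt
        (hmono (by linarith [neg_abs_le t]))
    · exact (hmono (by linarith [le_abs_self t])).trans_le
        (hup (|t| + 1) (by linarith [abs_nonneg t]))
  · rintro c ⟨hc1, hc2⟩
    refine mem_range_of_exists_le_of_exists_ge hcont ?_ ?_
    · obtain ⟨t, h1, h2⟩ := (((htend im _ tendsto_inv_atBot_zero).eventually
        (gt_mem_nhds hc1)).and (Filter.eventually_lt_atBot 0)).exists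
      refine ⟨t, le_trans ?_ h1.le⟩
      rw [← Real.rpow_le_rpow_iff_of_neg (hbpos im t) (hPpos t) h2, hmulpow im t h2.ne,
        ← hpow t h2.ne]
      exact hterm im t
    · obtain ⟨t, h1, h2⟩ := (((htend iM _ tendsto_inv_atTop_zero).eventually
        (lt_mem_nhds hc2)).and (Filter.eventually_gt_atTop 0)).exists
      refine ⟨t, le_trans h1.le ?_⟩
      rw [← Real.rpow_le_rpow_iff (hbpos iM t).le (hPpos t).le h2, hmulpow iM t h2.ne',
        ← hpow t h2.ne']
      exact hterm iM t
end

section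
/- Let (aᵢ) and (pᵢ) be sequences of positive real numbers with aᵢ → 1 and aᵢ ≠ 1 for all i. If m : (0, ∞) → ℝ is a continuous function satisfying m(aᵢ · y) = pᵢ · m(y) for all y > 0 and all i ∈ ℕ, then there exist real numbers α and β such that m(x) = α · x^β for all x > 0. -/
/-- Lemma (functional equation, multiplicative form): if `aᵢ → 1`, `aᵢ ≠ 1`, `aᵢ, pᵢ > 0`,
and a continuous `m : (0,∞) → ℝ` satisfies `m (aᵢ y) = pᵢ m y` for all `y > 0` and all `i`,
then `m x = α x ^ β` for some reals `α, β`. -/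
theorem stmt_4 (a p : ℕ → ℝ) (ha_pos : ∀ i, 0 < a i) (hp_pos : ∀ i, 0 < p i)
    (ha_ne : ∀ i, a i ≠ 1) (ha_lim : Filter.Tendsto a Filter.atTop (nhds 1))
    (m : ℝ → ℝ) (hm_cont : ContinuousOn m (Set.Ioi 0))
    (hfe : ∀ y : ℝ, 0 < y → ∀ i : ℕ, m (a i * y) = p i * m y) :
    ∃ α β : ℝ, ∀ x : ℝ, 0 < x → m x = α * x ^ β := by
  classical
  set f : ℝ → ℝ := fun t => m (Real.exp t) with hf
  have fc : Continuous f := by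
    rw [hf]
    exact hm_cont.comp_continuous Real.continuous_exp (fun x => Real.exp_pos x)
  let S : AddSubgroup ℝ :=
    { carrier := {c | ∃ q : ℝ, 0 < q ∧ ∀ t, f (c + t) = q * f t}
      zero_mem' := ⟨1, one_pos, fun t => by simp⟩
      add_mem' := by
        rintro c d ⟨q, hq, h⟩ ⟨r, hr, h'⟩
        exact ⟨q * r, mul_pos hq hr, fun t => by rw [add_assoc, h, h', mul_assoc]⟩
      neg_mem' := by
        rintro c ⟨q, hq, h⟩
        refine ⟨q⁻¹, inv_pos.2 hq, fun t => ?_⟩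
        have := h (-c + t)
        rw [add_neg_cancel_left] at this
        rw [this, inv_mul_cancel_left₀ hq.ne'] }
  have hb : ∀ i, Real.log (a i) ∈ S := fun i => ⟨p i, hp_pos i, fun t => by
    simp only [hf]
    rw [Real.exp_add, Real.exp_log (ha_pos i), hfe _ (Real.exp_pos t)]⟩
  have hlim : Filter.Tendsto (fun i => |Real.log (a i)|) Filter.atTop (nhds 0) := by
    have := ((Real.continuousAt_log one_ne_zero).tendsto.comp ha_lim).abs
    simpa using this
  have hd : Dense (S : Set ℝ) := by
    apply AddSubgroup.dense_of_not_isolated_zero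
    intro ε hε
    obtain ⟨i, hi⟩ := (hlim.eventually (gt_mem_nhds hε)).exists
    refine ⟨|Real.log (a i)|, ?_, abs_pos.2 ?_, hi⟩
    · rcases abs_choice (Real.log (a i)) with h | h <;> rw [h]
      · exact hb i
      · exact S.neg_mem (hb i)
    · exact Real.log_ne_zero_of_pos_of_ne_one (ha_pos i) (ha_ne i)
  have key : ∀ s t, f (s + t) * f 0 = f s * f t := by
    intro s t
    have : (fun s => f (s + t) * f 0) = fun s => f s * f t := by
      apply Continuous.ext_on hd (by fun_prop) (by fun_prop)
      rintro c ⟨q, hq, h⟩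
      have h0 := h 0
      rw [add_zero] at h0
      simp only
      rw [h, h0]; ring
    exact congrFun this s
  have back : ∀ x, 0 < x → m x = f (Real.log x) := fun x hx => by
    simp only [hf]; rw [Real.exp_log hx]
  by_cases h0 : f 0 = 0
  · refine ⟨0, 0, fun x hx => ?_⟩
    have := key (Real.log x) (Real.log x)
    rw [h0, mul_zero] at this
    rw [back x hx, zero_mul]
    exact mul_self_eq_zero.1 this.symm
  have hne : ∀ t, f t ≠ 0 := by
    intro t ht
    have := key t (-t)
    rw [add_neg_cancel, ht, zero_mul] at this
    exact h0 (mul_self_eq_zero.1 this)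
  have hpos : ∀ t, 0 < f t / f 0 := by
    intro t
    have h := key (t / 2) (t / 2)
    rw [add_halves] at h
    have : f t / f 0 = (f (t / 2) / f 0) ^ 2 := by
      field_simp
      linarith
    rw [this]
    have h3 : f (t / 2) / f 0 ≠ 0 := div_ne_zero (hne _) h0
    exact lt_of_le_of_ne (sq_nonneg _) (pow_ne_zero 2 h3).symm
  let L : ℝ →+ ℝ := AddMonoidHom.mk' (fun t => Real.log (f t / f 0)) (by
    intro s t
    rw [← Real.log_mul (hpos s).ne' (hpos t).ne']
    congr 1
    have := key s t
    field_simp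
    linarith)
  have Lc : Continuous L :=
    Continuous.log (fc.div_const _) (fun t => (hpos t).ne')
  refine ⟨f 0, L 1, fun x hx => ?_⟩
  have h1 : L (Real.log x) = Real.log x * L 1 := by
    have := map_real_smul L Lc (Real.log x) 1
    simpa using this
  have h2 : Real.exp (L (Real.log x)) = f (Real.log x) / f 0 := Real.exp_log (hpos _)
  rw [back x hx, Real.rpow_def_of_pos hx, ← h1, h2]
  field_simp
end

section
/- Let (aᵢ) be a sequence of real numbers with aᵢ → 0 and aᵢ ≠ 0 for all i, and let (pᵢ) be a sequence of real numbers. If m : ℝ → ℝ is a continuous function satisfying m(aᵢ + y) = pᵢ + m(y) for all y ∈ ℝ and all i ∈ ℕ, then there exist real numbers α and β such that m(x) = α + β · x for all x ∈ ℝ. -/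
/-- Lemma (functional equation, additive form): if `aᵢ → 0`, `aᵢ ≠ 0`,
and a continuous `m : ℝ → ℝ` satisfies `m (aᵢ + y) = pᵢ + m y` for all `y` and all `i`,
then `m x = α + β x` for some reals `α, β`. -/
theorem stmt_5 (a p : ℕ → ℝ) (ha_ne : ∀ i, a i ≠ 0)
    (ha_lim : Filter.Tendsto a Filter.atTop (nhds 0))
    (m : ℝ → ℝ) (hm_cont : Continuous m)
    (hfe : ∀ y : ℝ, ∀ i : ℕ, m (a i + y) = p i + m y) :
    ∃ α β : ℝ, ∀ x : ℝ, m x = α + β * x := by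
  let S : AddSubgroup ℝ :=
    { carrier := {t | ∀ y, m (t + y) = m t - m 0 + m y}
      zero_mem' := by intro y; simp
      add_mem' := by
        intro s t hs ht y
        have h1 := hs (t + y)
        have h2 := ht y
        have h3 := hs t
        rw [add_assoc, h1, h2, h3]
        ring
      neg_mem' := by
        intro t ht y
        have h1 := ht (-t + y)
        have h2 := ht (-t)
        rw [add_neg_cancel_left] at h1
        rw [add_neg_cancel] at h2
        linarith }
  have hmem : ∀ i, a i ∈ S := by
    intro i y
    have h0 := hfe 0 i
    rw [add_zero] at h0
    rw [hfe y i, h0]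
    ring
  have hdense : Dense (S : Set ℝ) := by
    apply AddSubgroup.dense_of_not_isolated_zero
    intro ε hε
    obtain ⟨i, hi⟩ := (Metric.tendsto_atTop.1 ha_lim) ε hε
    have hi := hi i le_rfl
    rw [Real.dist_eq, sub_zero] at hi
    refine ⟨|a i|, ?_, abs_pos.2 (ha_ne i), hi⟩
    rcases abs_choice (a i) with h | h
    · rw [h]; exact hmem i
    · rw [h]; exact S.neg_mem (hmem i)
  have hadd : ∀ t y, m (t + y) = m t - m 0 + m y := by
    intro t y
    have : (fun t => m (t + y)) = fun t => m t - m 0 + m y :=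
      Continuous.ext_on hdense (by fun_prop) (by fun_prop) (fun s hs => hs y)
    exact congrFun this t
  let f : ℝ →+ ℝ :=
    { toFun := fun x => m x - m 0
      map_zero' := by simp
      map_add' := by intro x y; rw [hadd x y]; ring }
  have hf : Continuous f := by
    change Continuous fun x => m x - m 0
    fun_prop
  refine ⟨m 0, f 1, fun x => ?_⟩
  have h := map_real_smul f hf x 1
  rw [smul_eq_mul, smul_eq_mul, mul_one] at h
  have h' : m x - m 0 = x * f 1 := h
  linarith
end

section
/- Let U and V be nonempty open intervals of ℝ with V ⊆ U, let f : U → ℝ be continuous and strictly monotone, and let η : V → U be an injective function such that for all x, y ∈ V and all w ∈ (0,1), whenever t ∈ U satisfies f(t) = w·f(x) + (1−w)·f(y), then f(η(t)) = w·f(η(x)) + (1−w)·f(η(y)). Then η is continuous on V and strictly monotone (either strictly increasing or strictly decreasing). -/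
theorem neutral_aux (U V : Set ℝ)
    (hU_open : IsOpen U)
    (hV_ne : V.Nonempty) (hV_open : IsOpen V)
    (hVU : V ⊆ U)
    (f : ℝ → ℝ) (hf_cont : ContinuousOn f U)
    (hf : StrictMonoOn f U)
    (η : ℝ → ℝ) (hη_maps : Set.MapsTo η V U) (hη_inj : Set.InjOn η V)
    (hη_neutral : ∀ x ∈ V, ∀ y ∈ V, ∀ w ∈ Set.Ioo (0 : ℝ) 1, ∀ t ∈ U,
      f t = w * f x + (1 - w) * f y →
      f (η t) = w * f (η x) + (1 - w) * f (η y)) :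
    ContinuousOn η V ∧ (StrictMonoOn η V ∨ StrictAntiOn η V) := by
  -- collinearity for ordered triples
  have key : ∀ x ∈ V, ∀ t ∈ V, ∀ y ∈ V, x < t → t < y →
      (f (η t) - f (η x)) * (f y - f x) = (f (η y) - f (η x)) * (f t - f x) := by
    intro x hx t ht y hy hxt hty
    have h1 := hf (hVU hx) (hVU ht) hxt
    have h2 := hf (hVU ht) (hVU hy) hty
    have h3 : 0 < f y - f x := by linarith
    have hw := hη_neutral x hx y hy ((f y - f t) / (f y - f x))
      ⟨div_pos (by linarith) h3, (div_lt_one h3).2 (by linarith)⟩ t (hVU ht)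
      (by field_simp; ring)
    rw [hw]; field_simp; ring
  obtain ⟨p, hp⟩ := hV_ne
  obtain ⟨q, hpq, hq⟩ : ∃ q, p < q ∧ q ∈ V := by
    have h1 : ∀ᶠ q in nhdsWithin p (Set.Ioi p), q ∈ V :=
      nhdsWithin_le_nhds (hV_open.mem_nhds hp)
    have h2 : ∀ᶠ q in nhdsWithin p (Set.Ioi p), p < q := self_mem_nhdsWithin
    exact (h2.and h1).exists
  have hfpq := hf (hVU hp) (hVU hq) hpq
  have hd : f q - f p ≠ 0 := by linarith
  obtain ⟨a, ha⟩ : ∃ a, a = (f (η q) - f (η p)) / (f q - f p) := ⟨_, rfl⟩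
  have ha0 : a ≠ 0 := by
    rw [ha]
    refine div_ne_zero ?_ hd
    intro h
    have h2 := hf.injOn (hη_maps hq) (hη_maps hp) (by linarith)
    exact hpq.ne' (hη_inj hq hp h2)
  have haff : ∀ t ∈ V, f (η t) = a * f t + (f (η p) - a * f p) := by
    intro t ht
    have e : (f (η t) - f (η p)) * (f q - f p) = (f (η q) - f (η p)) * (f t - f p) := by
      rcases lt_trichotomy t p with h | h | h
      · have := key t ht p hp q hq h hpq
        linarith
      · subst h; ring
      · rcases lt_trichotomy t q with h' | h' | h'
        · exact key p hp t ht q hq h h'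
        · subst h'; ring
        · have := key p hp q hq t ht hpq h'
          linarith
    have e2 : f (η t) - f (η p) = a * (f t - f p) := by
      rw [ha, div_mul_eq_mul_div, eq_div_iff hd, e]
    linarith
  have hcomp : ContinuousOn (fun t => f (η t)) V :=
    ((continuousOn_const.mul (hf_cont.mono hVU)).add continuousOn_const).congr haff
  refine ⟨?_, ?_⟩
  · intro x hx
    have hc := hcomp x hx
    have hmem : U ∈ nhds (η x) := hU_open.mem_nhds (hη_maps hx)
    refine tendsto_order.2 ⟨fun l hl => ?_, fun l hl => ?_⟩
    · obtain ⟨m, hm, hm2⟩ : ∃ m, m ∈ Set.Ioo l (η x) ∧ m ∈ U := by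
        have h1 : ∀ᶠ m in nhdsWithin (η x) (Set.Iio (η x)), m ∈ U := nhdsWithin_le_nhds hmem
        exact (Filter.Eventually.and (Ioo_mem_nhdsLT hl) h1).exists
      have h := (tendsto_order.1 hc).1 (f m) (hf hm2 (hη_maps hx) hm.2)
      filter_upwards [h, self_mem_nhdsWithin] with y hy hyV
      exact hm.1.trans ((hf.lt_iff_lt hm2 (hη_maps hyV)).1 hy)
    · obtain ⟨m, hm, hm2⟩ : ∃ m, m ∈ Set.Ioo (η x) l ∧ m ∈ U := by
        have h1 : ∀ᶠ m in nhdsWithin (η x) (Set.Ioi (η x)), m ∈ U := nhdsWithin_le_nhds hmem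
        exact (Filter.Eventually.and (Ioo_mem_nhdsGT hl) h1).exists
      have h := (tendsto_order.1 hc).2 (f m) (hf (hη_maps hx) hm2 hm.1)
      filter_upwards [h, self_mem_nhdsWithin] with y hy hyV
      exact ((hf.lt_iff_lt (hη_maps hyV) hm2).1 hy).trans hm.2
  · rcases lt_or_gt_of_ne ha0 with h | h
    · right
      intro x hx y hy hxy
      refine (hf.lt_iff_lt (hη_maps hy) (hη_maps hx)).1 ?_
      rw [haff x hx, haff y hy]
      have := mul_lt_mul_of_neg_left (hf (hVU hx) (hVU hy) hxy) h
      linarith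
    · left
      intro x hx y hy hxy
      refine (hf.lt_iff_lt (hη_maps hx) (hη_maps hy)).1 ?_
      rw [haff x hx, haff y hy]
      have := mul_lt_mul_of_pos_left (hf (hVU hx) (hVU hy) hxy) h
      linarith

/-- If `η : V → U` is injective and intertwines the two-point weighted quasi-arithmetic
mean generated by a continuous strictly monotone `f : U → ℝ` (i.e. `η` is `f`-neutral),
then `η` is continuous and strictly monotone on `V`. -/
theorem stmt_6 (U V : Set ℝ)
    (hU_ne : U.Nonempty) (hU_open : IsOpen U) (hU_conn : U.OrdConnected)
    (hV_ne : V.Nonempty) (hV_open : IsOpen V) (hV_conn : V.OrdConnected)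
    (hVU : V ⊆ U)
    (f : ℝ → ℝ) (hf_cont : ContinuousOn f U)
    (hf_mono : StrictMonoOn f U ∨ StrictAntiOn f U)
    (η : ℝ → ℝ) (hη_maps : Set.MapsTo η V U) (hη_inj : Set.InjOn η V)
    (hη_neutral : ∀ x ∈ V, ∀ y ∈ V, ∀ w ∈ Set.Ioo (0 : ℝ) 1, ∀ t ∈ U,
      f t = w * f x + (1 - w) * f y →
      f (η t) = w * f (η x) + (1 - w) * f (η y)) :
    ContinuousOn η V ∧ (StrictMonoOn η V ∨ StrictAntiOn η V) := by
  rcases hf_mono with h | h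
  · exact neutral_aux U V hU_open hV_ne hV_open hVU f hf_cont h η hη_maps hη_inj hη_neutral
  · refine neutral_aux U V hU_open hV_ne hV_open hVU (fun x => -f x) hf_cont.neg
      (fun x hx y hy hxy => neg_lt_neg (h hx hy hxy)) η hη_maps hη_inj ?_
    intro x hx y hy w hw t ht e
    have := hη_neutral x hx y hy w hw t ht (by linarith)
    linarith
end

section
/- Let U and V be nonempty open intervals of ℝ with V ⊆ U, let f : U → ℝ be continuous and strictly monotone, and let η : V → U be an injective function such that for all x, y ∈ V and all w ∈ (0,1), whenever t ∈ U satisfies f(t) = w·f(x) + (1−w)·f(y), then f(η(t)) = w·f(η(x)) + (1−w)·f(η(y)). Then there exist real numbers a ≠ 0 and b such that f(η(x)) = a·f(x) + b for all x ∈ V. -/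
/-- If `η : V → U` is injective and intertwines the two-point weighted quasi-arithmetic
mean generated by a continuous strictly monotone `f : U → ℝ` (i.e. `η` is `f`-neutral),
then `f ∘ η = a f + b` on `V` for some reals `a ≠ 0` and `b`. -/
theorem stmt_7 (U V : Set ℝ)
    (hU_ne : U.Nonempty) (hU_open : IsOpen U) (hU_conn : U.OrdConnected)
    (hV_ne : V.Nonempty) (hV_open : IsOpen V) (hV_conn : V.OrdConnected)
    (hVU : V ⊆ U)
    (f : ℝ → ℝ) (hf_cont : ContinuousOn f U)
    (hf_mono : StrictMonoOn f U ∨ StrictAntiOn f U)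
    (η : ℝ → ℝ) (hη_maps : Set.MapsTo η V U) (hη_inj : Set.InjOn η V)
    (hη_neutral : ∀ x ∈ V, ∀ y ∈ V, ∀ w ∈ Set.Ioo (0 : ℝ) 1, ∀ t ∈ U,
      f t = w * f x + (1 - w) * f y →
      f (η t) = w * f (η x) + (1 - w) * f (η y)) :
    ∃ a b : ℝ, a ≠ 0 ∧ ∀ x ∈ V, f (η x) = a * f x + b := by
  have hfinj : Set.InjOn f U := by
    rcases hf_mono with h | h
    · exact h.injOn
    · exact h.injOn
  have key : ∀ x ∈ V, ∀ y ∈ V, ∀ t ∈ V, f x < f t → f t < f y →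
      (f (η t) - f (η x)) * (f y - f x) = (f (η y) - f (η x)) * (f t - f x) := by
    intro x hx y hy t ht h1 h2
    have hd : 0 < f y - f x := by linarith
    have hw := hη_neutral x hx y hy ((f y - f t) / (f y - f x))
      ⟨div_pos (by linarith) hd, by rw [div_lt_one hd]; linarith⟩ t (hVU ht)
      (by field_simp; ring)
    rw [hw]
    field_simp
    ring
  obtain ⟨p, hp⟩ := hV_ne
  obtain ⟨q, hq, hpq⟩ : ∃ q ∈ V, p < q := by
    obtain ⟨ε, hε, hb⟩ := Metric.isOpen_iff.1 hV_open p hp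
    refine ⟨p + ε / 2, hb ?_, by linarith⟩
    rw [Metric.mem_ball, Real.dist_eq, add_sub_cancel_left, abs_of_pos (by linarith)]
    linarith
  have hf : f q - f p ≠ 0 := fun h =>
    hpq.ne' (hfinj (hVU hq) (hVU hp) (sub_eq_zero.1 h))
  have hg : f (η q) - f (η p) ≠ 0 := fun h =>
    hpq.ne' (hη_inj hq hp (hfinj (hη_maps hq) (hη_maps hp) (sub_eq_zero.1 h)))
  have main : ∀ x ∈ V,
      (f (η x) - f (η p)) * (f q - f p) = (f (η q) - f (η p)) * (f x - f p) := by
    intro x hx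
    rcases lt_trichotomy (f x) (f p) with h1 | h1 | h1
    · rcases lt_trichotomy (f x) (f q) with h2 | h2 | h2
      · rcases lt_or_gt_of_ne hf with h3 | h3
        · linarith [key x hx p hp q hq h2 (by linarith)]
        · linarith [key x hx q hq p hp h1 (by linarith)]
      · rw [hfinj (hVU hx) (hVU hq) h2]
      · linarith [key q hq p hp x hx h2 h1]
    · rw [hfinj (hVU hx) (hVU hp) h1]; ring
    · rcases lt_trichotomy (f x) (f q) with h2 | h2 | h2
      · linarith [key p hp q hq x hx h1 h2]
      · rw [hfinj (hVU hx) (hVU hq) h2]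
      · rcases lt_or_gt_of_ne hf with h3 | h3
        · linarith [key q hq x hx p hp (by linarith) h1]
        · linarith [key p hp x hx q hq (by linarith) h2]
  refine ⟨(f (η q) - f (η p)) / (f q - f p),
    f (η p) - (f (η q) - f (η p)) / (f q - f p) * f p, div_ne_zero hg hf, ?_⟩
  intro x hx
  have h := main x hx
  have h' : f (η x) - f (η p) = (f (η q) - f (η p)) / (f q - f p) * (f x - f p) := by
    rw [div_mul_eq_mul_div, eq_div_iff hf, h]
  linarith
end

section
/- Let U ⊆ ℝ be a nonempty interval and f : U → ℝ continuous and strictly monotone with f(U) = ℝ. Let a ≠ 0 and b be real numbers and define η : U → U by η(x) = f⁻¹(a·f(x) + b). Let p be the unique real number with p³ = a and set q = b/(p² + p + 1). Then the function μ : U → U defined by μ(x) = f⁻¹(p·f(x) + q) satisfies μ(μ(μ(x))) = η(x) for all x ∈ U; moreover, if p', q' are real numbers with p' ≠ 0 such that the function μ'(x) = f⁻¹(p'·f(x) + q') also satisfies μ'(μ'(μ'(x))) = η(x) for all x ∈ U, then p' = p and q' = q. -/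
/-- Cube-root lemma: for `f : U → ℝ` continuous, strictly monotone, onto `ℝ`, every
function `η = f⁻¹ ∘ (a·f + b)` with `a ≠ 0` has a unique cube root of the same form,
namely `μ = f⁻¹ ∘ (p·f + q)` where `p³ = a` and `q = b / (p² + p + 1)`. -/
theorem stmt_9 (U : Set ℝ) (hU_ne : U.Nonempty) (hU_conn : U.OrdConnected)
    (f : ℝ → ℝ) (hf_cont : ContinuousOn f U)
    (hf_mono : StrictMonoOn f U ∨ StrictAntiOn f U)
    (hf_im : f '' U = Set.univ)
    (finv : ℝ → ℝ) (hfinv_left : ∀ x ∈ U, finv (f x) = x)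
    (hfinv_right : ∀ y : ℝ, finv y ∈ U ∧ f (finv y) = y)
    (a b : ℝ) (ha_ne : a ≠ 0)
    (η : ℝ → ℝ) (hη : ∀ x ∈ U, η x = finv (a * f x + b))
    (p : ℝ) (hp : p ^ 3 = a)
    (q : ℝ) (hq : q = b / (p ^ 2 + p + 1))
    (μ : ℝ → ℝ) (hμ : ∀ x ∈ U, μ x = finv (p * f x + q)) :
    (∀ x ∈ U, μ (μ (μ x)) = η x) ∧
    (∀ (p' q' : ℝ) (μ' : ℝ → ℝ), p' ≠ 0 →
      (∀ x ∈ U, μ' x = finv (p' * f x + q')) →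
      (∀ x ∈ U, μ' (μ' (μ' x)) = η x) →
      p' = p ∧ q' = q) := by
  have key : ∀ (r s : ℝ) (ν : ℝ → ℝ), (∀ x ∈ U, ν x = finv (r * f x + s)) →
      ∀ x ∈ U, ν (ν (ν x)) = finv (r ^ 3 * f x + s * (r ^ 2 + r + 1)) := by
    intro r s ν hν x hx
    rw [hν x hx, hν _ (hfinv_right _).1, (hfinv_right _).2, hν _ (hfinv_right _).1,
      (hfinv_right _).2]
    congr 1
    ring
  have hpos : p ^ 2 + p + 1 ≠ 0 := by nlinarith [sq_nonneg (p + 1 / 2)]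
  refine ⟨?_, ?_⟩
  · intro x hx
    rw [key p q μ hμ x hx, hη x hx, hp, hq, div_mul_cancel₀ _ hpos]
  · intro p' q' μ' _ hμ' hcube
    have h : ∀ y : ℝ, p' ^ 3 * y + q' * (p' ^ 2 + p' + 1) = a * y + b := by
      intro y
      have h1 := hcube (finv y) (hfinv_right y).1
      rw [key p' q' μ' hμ' _ (hfinv_right y).1, hη _ (hfinv_right y).1,
        (hfinv_right y).2] at h1
      have h2 := congrArg f h1
      rwa [(hfinv_right _).2, (hfinv_right _).2] at h2
    have h0 := h 0
    have h1 := h 1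
    have hc : p' ^ 3 = p ^ 3 := by linarith
    have hpp : p' = p := (Odd.strictMono_pow (by decide : Odd 3)).injective hc
    refine ⟨hpp, ?_⟩
    subst hpp
    rw [hq, eq_div_iff hpos]
    linarith
end

section
/- Let U ⊆ ℝ be a nonempty interval and f : U → ℝ continuous and strictly monotone with f(U) = ℝ. Let a > 0 and b ∈ ℝ, and define η(x) = f⁻¹(a·f(x) + b). Define sequences (pₙ) and (qₙ) by p₀ = a, q₀ = b, pₙ₊₁ = pₙ^(1/3), and qₙ₊₁ = qₙ/(pₙ^(2/3) + pₙ^(1/3) + 1), and set ηₙ(x) = f⁻¹(pₙ·f(x) + qₙ). Then for every n, the 3ⁿ-fold iterate of ηₙ equals η (that is, ηₙ^(∘3ⁿ) = η on U), pₙ → 1, qₙ → 0, and ηₙ(x) → x for every x ∈ U. -/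
theorem aux_cont (U : Set ℝ) (hU : U.OrdConnected) (g : ℝ → ℝ) (hg : StrictMono g)
    (hr : Set.range g = U) : Continuous g := by
  rw [continuous_iff_continuousAt]
  intro y
  refine continuousAt_of_monotoneOn_of_image_mem_nhds (s := Set.univ) (hg.monotone.monotoneOn _)
    Filter.univ_mem ?_
  rw [Set.image_univ, hr]
  refine Filter.mem_of_superset (Icc_mem_nhds (hg (sub_one_lt y)) (hg (lt_add_one y))) ?_
  exact hU.out (hr ▸ Set.mem_range_self _) (hr ▸ Set.mem_range_self _)

theorem aux_iter (U : Set ℝ) (g h : ℝ → ℝ) (hm : Set.MapsTo h U U) (he : Set.EqOn g h U) (k : ℕ) :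
    Set.EqOn (g^[k]) (h^[k]) U := by
  induction k with
  | zero => intro x _; rfl
  | succ k ih =>
    intro x hx
    rw [Function.iterate_succ_apply, Function.iterate_succ_apply, he hx]
    exact ih (hm hx)

/-- Iterated cube roots of an `f`-neutral function `η = f⁻¹ ∘ (a·f + b)` (`a > 0`):
setting `p₀ = a`, `q₀ = b`, `pₙ₊₁ = pₙ^(1/3)`, `qₙ₊₁ = qₙ / (pₙ^(2/3) + pₙ^(1/3) + 1)`
and `ηₙ = f⁻¹ ∘ (pₙ·f + qₙ)`, the `3ⁿ`-fold iterate of `ηₙ` equals `η` on `U`,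
`pₙ → 1`, `qₙ → 0`, and `ηₙ → id` pointwise on `U`. -/
theorem stmt_10 (U : Set ℝ) (hU_ne : U.Nonempty) (hU_conn : U.OrdConnected)
    (f : ℝ → ℝ) (hf_cont : ContinuousOn f U)
    (hf_mono : StrictMonoOn f U ∨ StrictAntiOn f U)
    (hf_im : f '' U = Set.univ)
    (finv : ℝ → ℝ) (hfinv_left : ∀ x ∈ U, finv (f x) = x)
    (hfinv_right : ∀ y : ℝ, finv y ∈ U ∧ f (finv y) = y)
    (a b : ℝ) (ha_pos : 0 < a)
    (η : ℝ → ℝ) (hη : ∀ x ∈ U, η x = finv (a * f x + b))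
    (p q : ℕ → ℝ) (hp0 : p 0 = a) (hq0 : q 0 = b)
    (hp_succ : ∀ n, p (n + 1) = (p n) ^ ((1 : ℝ) / 3))
    (hq_succ : ∀ n, q (n + 1) = q n / ((p n) ^ ((2 : ℝ) / 3) + (p n) ^ ((1 : ℝ) / 3) + 1))
    (ηs : ℕ → ℝ → ℝ) (hηs : ∀ n, ∀ x ∈ U, ηs n x = finv (p n * f x + q n)) :
    (∀ n, ∀ x ∈ U, (ηs n)^[3 ^ n] x = η x) ∧
    Filter.Tendsto p Filter.atTop (nhds 1) ∧
    Filter.Tendsto q Filter.atTop (nhds 0) ∧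
    (∀ x ∈ U, Filter.Tendsto (fun n => ηs n x) Filter.atTop (nhds x)) := by
  have hppos : ∀ n, 0 < p n := by
    intro n
    induction n with
    | zero => rw [hp0]; exact ha_pos
    | succ k ih => rw [hp_succ]; exact Real.rpow_pos_of_pos ih _
  have hcube : ∀ n, p (n + 1) ^ 3 = p n := by
    intro n
    rw [hp_succ, ← Real.rpow_natCast, ← Real.rpow_mul (hppos n).le]
    norm_num
  have hsq : ∀ n, (p n) ^ ((2 : ℝ) / 3) = p (n + 1) ^ 2 := by
    intro n
    rw [hp_succ, ← Real.rpow_natCast, ← Real.rpow_mul (hppos n).le]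
    norm_num
  have hq' : ∀ n, q (n + 1) = q n / (p (n + 1) ^ 2 + p (n + 1) + 1) := by
    intro n
    rw [hq_succ, hsq, ← hp_succ]
  have hden : ∀ n, 0 < p (n + 1) ^ 2 + p (n + 1) + 1 := by
    intro n
    have := hppos (n + 1)
    positivity
  have hqmul : ∀ n, q (n + 1) * (p (n + 1) ^ 2 + p (n + 1) + 1) = q n := by
    intro n
    rw [hq' n, div_mul_cancel₀ _ (hden n).ne']
  have hmaps : ∀ n, Set.MapsTo (ηs n) U U := by
    intro n x hx
    rw [hηs n x hx]
    exact (hfinv_right _).1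
  have hfη : ∀ n, ∀ x ∈ U, f (ηs n x) = p n * f x + q n := by
    intro n x hx
    rw [hηs n x hx]
    exact (hfinv_right _).2
  have hstep : ∀ n, Set.EqOn ((ηs (n + 1))^[3]) (ηs n) U := by
    intro n x hx
    have h1 := hmaps (n + 1) hx
    have h2 := hmaps (n + 1) h1
    change ηs (n + 1) (ηs (n + 1) (ηs (n + 1) x)) = ηs n x
    rw [hηs (n + 1) _ h2, hfη _ _ h1, hfη _ _ hx, hηs n x hx]
    congr 1
    rw [← hcube n, ← hqmul n]
    ring
  have hpt : Filter.Tendsto p Filter.atTop (nhds 1) := by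
    have hform : ∀ n, p n = a ^ (((1 : ℝ) / 3) ^ n) := by
      intro n
      induction n with
      | zero => simp [hp0]
      | succ k ih => rw [hp_succ, ih, ← Real.rpow_mul ha_pos.le, pow_succ]
    have h0 : Filter.Tendsto (fun n : ℕ => ((1 : ℝ) / 3) ^ n) Filter.atTop (nhds 0) :=
      tendsto_pow_atTop_nhds_zero_of_lt_one (by norm_num) (by norm_num)
    have h1 := (Real.continuousAt_const_rpow (a := a) (b := 0) ha_pos.ne').tendsto.comp h0
    rw [Real.rpow_zero] at h1
    exact h1.congr (fun n => (hform n).symm)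
  have hqt : Filter.Tendsto q Filter.atTop (nhds 0) := by
    obtain ⟨m, hm0, hm1, hma⟩ : ∃ m : ℝ, 0 < m ∧ m ≤ 1 ∧ m ≤ a :=
      ⟨min 1 a, lt_min one_pos ha_pos, min_le_left _ _, min_le_right _ _⟩
    have hpm : ∀ n, m ≤ p n := by
      intro n
      induction n with
      | zero => rw [hp0]; exact hma
      | succ k ih =>
        by_contra! hlt
        have h1 : p (k + 1) ^ 3 < m ^ 3 := pow_lt_pow_left₀ hlt (hppos _).le (by norm_num)
        have h2 : m ^ 3 ≤ m := pow_le_of_le_one hm0.le hm1 (by norm_num)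
        rw [hcube] at h1
        linarith
    have hb : ∀ n, |q n| ≤ |b| * (1 / (1 + m)) ^ n := by
      intro n
      induction n with
      | zero => simp [hq0]
      | succ k ih =>
        rw [hq', abs_div, abs_of_pos (hden k), pow_succ (1 / (1 + m)) k, ← mul_assoc, mul_one_div]
        have h1 : 1 + m ≤ p (k + 1) ^ 2 + p (k + 1) + 1 := by
          nlinarith [hpm (k + 1), sq_nonneg (p (k + 1))]
        have h2 : 0 < 1 + m := by linarith
        exact div_le_div₀ (le_trans (abs_nonneg _) ih) ih h2 h1
    have h0 : Filter.Tendsto (fun n : ℕ => |b| * (1 / (1 + m)) ^ n) Filter.atTop (nhds 0) := by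
      have := (tendsto_pow_atTop_nhds_zero_of_lt_one (r := 1 / (1 + m)) (by positivity)
        (by rw [div_lt_one (by linarith)]; linarith)).const_mul |b|
      simpa using this
    exact squeeze_zero_norm (fun n => hb n) h0
  have hrange : Set.range finv = U := by
    ext x
    exact ⟨by rintro ⟨y, rfl⟩; exact (hfinv_right y).1, fun hx => ⟨f x, hfinv_left x hx⟩⟩
  have hcont : Continuous finv := by
    rcases hf_mono with hm | hm
    · refine aux_cont U hU_conn finv ?_ hrange
      intro y z hyz
      rw [← hm.lt_iff_lt (hfinv_right y).1 (hfinv_right z).1, (hfinv_right y).2,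
        (hfinv_right z).2]
      exact hyz
    · have hc : Continuous (fun y => finv (-y)) := by
        refine aux_cont U hU_conn _ ?_ ?_
        · intro y z hyz
          change finv (-y) < finv (-z)
          rw [← hm.lt_iff_gt (hfinv_right (-z)).1 (hfinv_right (-y)).1, (hfinv_right _).2,
            (hfinv_right _).2]
          linarith
        · rw [← hrange]
          exact neg_surjective.range_comp finv
      simpa [Function.comp_def] using hc.comp continuous_neg
  refine ⟨?_, hpt, hqt, ?_⟩
  · intro n
    induction n with
    | zero =>
      intro x hx
      rw [pow_zero, Function.iterate_one, hηs 0 x hx, hη x hx, hp0, hq0]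
    | succ k ih =>
      intro x hx
      rw [pow_succ', Function.iterate_mul, aux_iter U _ _ (hmaps k) (hstep k) _ hx]
      exact ih x hx
  · intro x hx
    have h1 : Filter.Tendsto (fun n => p n * f x + q n) Filter.atTop (nhds (f x)) := by
      simpa using (hpt.mul_const (f x)).add hqt
    have h2 := (hcont.tendsto (f x)).comp h1
    rw [hfinv_left x hx] at h2
    exact h2.congr (fun n => (hηs n x hx).symm)
end

section
/- Let f : ℝ → ℝ be continuous and strictly monotone, and suppose that for every a ∈ ℝ, all x, y ∈ ℝ and all w ∈ (0,1): whenever t ∈ ℝ satisfies f(t) = w·f(x) + (1−w)·f(y), then f(t + a) = w·f(x + a) + (1−w)·f(y + a). Then either there exist α ≠ 0, β ≠ 0 and γ ∈ ℝ with f(x) = α·exp(β·x) + γ for all x ∈ ℝ, or there exist α ≠ 0 and γ ∈ ℝ with f(x) = α·x + γ for all x ∈ ℝ. -/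
theorem additive_linear (g : ℝ → ℝ) (hc : Continuous g) (hadd : ∀ x y, g (x + y) = g x + g y)
    (x : ℝ) : g x = g 1 * x := by
  have := map_real_smul (AddMonoidHom.mk' g hadd) hc x (1 : ℝ)
  simp only [AddMonoidHom.mk'_apply, smul_eq_mul, mul_one] at this
  rw [this, mul_comm]

/-- If every translation `x ↦ x + a` is neutral for the quasi-arithmetic mean generated
by a continuous strictly monotone `f : ℝ → ℝ`, then `f = α exp (β x) + γ` or
`f = α x + γ`, i.e. the mean is a log-exp mean. -/
theorem stmt_12 (f : ℝ → ℝ) (hf_cont : Continuous f)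
    (hf_mono : StrictMono f ∨ StrictAnti f)
    (hinv : ∀ a x y : ℝ, ∀ w ∈ Set.Ioo (0 : ℝ) 1, ∀ t : ℝ,
      f t = w * f x + (1 - w) * f y →
      f (t + a) = w * f (x + a) + (1 - w) * f (y + a)) :
    (∃ α β γ : ℝ, α ≠ 0 ∧ β ≠ 0 ∧ ∀ x : ℝ, f x = α * Real.exp (β * x) + γ) ∨
    (∃ α γ : ℝ, α ≠ 0 ∧ ∀ x : ℝ, f x = α * x + γ) := by
  have hinj : Function.Injective f := hf_mono.elim (fun h => h.injective) (fun h => h.injective)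
  have key : ∀ a x t y : ℝ, 0 < (f t - f y) * (f x - f t) →
      (f t - f y) * (f (x + a) - f (y + a)) = (f x - f y) * (f (t + a) - f (y + a)) := by
    intro a x t y h
    have hne : f x - f y ≠ 0 := by
      intro h0
      have : f x = f y := by linarith
      rw [this] at h
      nlinarith [sq_nonneg (f t - f y)]
    have hpos : 0 < (f x - f y) ^ 2 := by positivity
    have hw : (f t - f y) / (f x - f y) ∈ Set.Ioo (0 : ℝ) 1 := by
      have e : (f t - f y) / (f x - f y) = (f t - f y) * (f x - f y) / (f x - f y) ^ 2 := by
        field_simp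
      rw [e]
      constructor
      · apply div_pos _ hpos
        nlinarith [sq_nonneg (f t - f y)]
      · rw [div_lt_one hpos]
        nlinarith [sq_nonneg (f x - f t)]
    have := hinv a x y _ hw t (by field_simp; ring)
    rw [this]
    field_simp
    ring
  have h10 : f 1 - f 0 ≠ 0 := by
    intro h0
    have : (1 : ℝ) = 0 := hinj (by linarith)
    norm_num at this
  have aff : ∀ a x : ℝ, (f 1 - f 0) * (f (x + a) - f a) = (f x - f 0) * (f (1 + a) - f a) := by
    intro a x
    by_cases hx0 : x = 0
    · subst hx0; simp
    by_cases hx1 : x = 1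
    · subst hx1; simp
    have n0 : f x ≠ f 0 := fun h => hx0 (hinj h)
    have n1 : f x ≠ f 1 := fun h => hx1 (hinj h)
    have A := key a 1 x 0
    have B := key a x 1 0
    have C := key a 1 0 x
    simp only [zero_add] at A B C
    rcases lt_or_gt_of_ne n0 with p | p <;> rcases lt_or_gt_of_ne n1 with q | q <;>
      rcases lt_or_gt_of_ne h10 with r | r <;>
      first
      | (exfalso; linarith)
      | linarith [A (mul_pos (by linarith) (by linarith))]
      | linarith [A (mul_pos_of_neg_of_neg (by linarith) (by linarith))]
      | linarith [B (mul_pos (by linarith) (by linarith))]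
      | linarith [B (mul_pos_of_neg_of_neg (by linarith) (by linarith))]
      | linarith [C (mul_pos (by linarith) (by linarith))]
      | linarith [C (mul_pos_of_neg_of_neg (by linarith) (by linarith))]
  obtain ⟨g, hg⟩ : ∃ g : ℝ → ℝ, ∀ x, g x = f x - f 0 := ⟨_, fun _ => rfl⟩
  obtain ⟨k, hk⟩ : ∃ k : ℝ → ℝ, ∀ a, k a = (f (1 + a) - f a) / (f 1 - f 0) := ⟨_, fun _ => rfl⟩
  have hgc : Continuous g := by
    rw [funext hg]; fun_prop
  have hg1 : g 1 ≠ 0 := by rw [hg]; exact h10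
  have hgk : ∀ x a, g (x + a) = g a + k a * g x := by
    intro x a
    have := aff a x
    rw [hg, hg, hg, hk]
    field_simp
    linarith
  obtain ⟨c, hc⟩ : ∃ c : ℝ, c = (k 1 - 1) / g 1 := ⟨_, rfl⟩
  have hkc : ∀ x, k x = 1 + c * g x := by
    intro x
    have h1 := hgk x 1
    have h2 := hgk 1 x
    rw [add_comm] at h2
    rw [hc]
    field_simp
    linarith
  by_cases hc0 : c = 0
  · right
    refine ⟨g 1, f 0, hg1, fun x => ?_⟩
    have := additive_linear g hgc (fun x y => by rw [hgk, hkc, hc0]; ring) x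
    rw [← this, hg]; ring
  · left
    have hkm : ∀ x a, k (x + a) = k x * k a := by
      intro x a
      rw [hkc (x + a), hgk, hkc x, hkc a]; ring
    have hk0 : k 0 = 1 := by rw [hkc, hg]; ring
    have hkne : ∀ x, k x ≠ 0 := by
      intro x h
      have := hkm x (-x)
      rw [h, add_neg_cancel, hk0] at this
      norm_num at this
    have hkpos : ∀ x, 0 < k x := by
      intro x
      have := hkm (x / 2) (x / 2)
      rw [add_halves] at this
      rw [this]
      exact mul_self_pos.2 (hkne _)
    have hkcont : Continuous k := by
      rw [funext hkc]; fun_prop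
    have hlin := additive_linear (fun x => Real.log (k x)) (hkcont.log hkne)
      (fun x y => by simp only [hkm]; exact Real.log_mul (hkne x) (hkne y))
    refine ⟨1 / c, Real.log (k 1), f 0 - 1 / c, one_div_ne_zero hc0, ?_, fun x => ?_⟩
    · intro h
      have h1 : k 1 = 1 := by rw [← Real.exp_log (hkpos 1), h, Real.exp_zero]
      exact hc0 (by rw [hc, h1]; simp)
    · rw [← hlin, Real.exp_log (hkpos x), hkc, hg]
      field_simp
      ring
end

section
/- Let f : (0,∞) → ℝ be continuous and strictly monotone, and suppose that for every c > 0, all x, y > 0 and all w ∈ (0,1): whenever t > 0 satisfies f(t) = w·f(x) + (1−w)·f(y), then f(c·t) = w·f(c·x) + (1−w)·f(c·y). Then either there exist α ≠ 0, β ≠ 0 and γ ∈ ℝ with f(x) = α·x^β + γ for all x > 0, or there exist α ≠ 0 and γ ∈ ℝ with f(x) = α·ln(x) + γ for all x > 0. -/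
/-- Continuous additive functions on the reals are linear. -/
theorem cauchy_linear (h : ℝ → ℝ) (hc : Continuous h) (ha : ∀ u v, h (u + v) = h u + h v)
    (u : ℝ) : h u = u * h 1 := by
  have := map_real_smul (AddMonoidHom.mk' h ha) hc u 1
  simpa using this

/-- The only homogeneous quasi-arithmetic means on `(0,∞)` are the power means: if the
quasi-arithmetic mean generated by a continuous strictly monotone `f : (0,∞) → ℝ` is
invariant under every scaling `x ↦ c x`, then `f = α x^β + γ` or `f = α ln x + γ`. -/
theorem stmt_13 (f : ℝ → ℝ) (hf_cont : ContinuousOn f (Set.Ioi 0))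
    (hf_mono : StrictMonoOn f (Set.Ioi 0) ∨ StrictAntiOn f (Set.Ioi 0))
    (hinv : ∀ c : ℝ, 0 < c → ∀ x : ℝ, 0 < x → ∀ y : ℝ, 0 < y →
      ∀ w ∈ Set.Ioo (0 : ℝ) 1, ∀ t : ℝ, 0 < t →
      f t = w * f x + (1 - w) * f y →
      f (c * t) = w * f (c * x) + (1 - w) * f (c * y)) :
    (∃ α β γ : ℝ, α ≠ 0 ∧ β ≠ 0 ∧ ∀ x : ℝ, 0 < x → f x = α * x ^ β + γ) ∨
    (∃ α γ : ℝ, α ≠ 0 ∧ ∀ x : ℝ, 0 < x → f x = α * Real.log x + γ) := by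
  have hinj : ∀ x y : ℝ, 0 < x → 0 < y → f x = f y → x = y := by
    intro x y hx hy h
    rcases hf_mono with hm | hm
    · exact hm.injOn hx hy h
    · exact hm.injOn hx hy h
  -- three points are sent to collinear points
  have key : ∀ c x t y : ℝ, 0 < c → 0 < x → x < t → t < y →
      (f t - f y) * (f (c * x) - f (c * y)) = (f (c * t) - f (c * y)) * (f x - f y) := by
    intro c x t y hc hx hxt hty
    have ht : 0 < t := hx.trans hxt
    have hy : 0 < y := ht.trans hty
    have hne : f x - f y ≠ 0 := fun h =>
      (hxt.trans hty).ne (hinj x y hx hy (sub_eq_zero.mp h))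
    have hw : (f t - f y) / (f x - f y) ∈ Set.Ioo (0 : ℝ) 1 := by
      rcases hf_mono with hm | hm
      · have h1 := hm hx ht hxt
        have h2 := hm ht hy hty
        constructor
        · exact div_pos_of_neg_of_neg (by linarith) (by linarith)
        · rw [div_lt_one_of_neg (by linarith)]; linarith
      · have h1 := hm hx ht hxt
        have h2 := hm ht hy hty
        constructor
        · exact div_pos (by linarith) (by linarith)
        · rw [div_lt_one (by linarith)]; linarith
    have := hinv c hc x hx y hy _ hw t ht (by field_simp; ring)
    rw [this]
    field_simp
    ring
  obtain ⟨g, hg⟩ : ∃ g : ℝ → ℝ, ∀ u, g u = f (Real.exp u) := ⟨_, fun _ => rfl⟩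
  have hgc : Continuous g := by
    have : g = fun u => f (Real.exp u) := funext hg
    rw [this]
    exact hf_cont.comp_continuous Real.continuous_exp (fun u => Real.exp_pos u)
  have hginj : ∀ u v, g u = g v → u = v := by
    intro u v h
    rw [hg, hg] at h
    exact Real.exp_injective (hinj _ _ (Real.exp_pos _) (Real.exp_pos _) h)
  have gkey : ∀ s x t y : ℝ, x < t → t < y →
      (g t - g y) * (g (s + x) - g (s + y)) = (g (s + t) - g (s + y)) * (g x - g y) := by
    intro s x t y h1 h2
    have := key (Real.exp s) (Real.exp x) (Real.exp t) (Real.exp y) (Real.exp_pos _)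
      (Real.exp_pos _) (Real.exp_lt_exp.mpr h1) (Real.exp_lt_exp.mpr h2)
    simpa only [hg, Real.exp_add] using this
  have gaff : ∀ s u : ℝ, (g (s + u) - g s) * (g 1 - g 0) = (g (s + 1) - g s) * (g u - g 0) := by
    intro s u
    rcases lt_trichotomy u 0 with h | h | h
    · have := gkey s u 0 1 h one_pos
      rw [add_zero] at this; linarith
    · subst h; simp
    · rcases lt_trichotomy u 1 with h' | h' | h'
      · have := gkey s 0 u 1 h h'
        rw [add_zero] at this; linarith
      · subst h'; ring
      · have := gkey s 0 1 u one_pos h'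
        rw [add_zero] at this; linarith
  obtain ⟨h, hh⟩ : ∃ h : ℝ → ℝ, ∀ u, h u = g u - g 0 := ⟨_, fun _ => rfl⟩
  have hhc : Continuous h := by
    have : h = fun u => g u - g 0 := funext hh
    rw [this]; fun_prop
  have h0 : h 0 = 0 := by simp [hh]
  have h1 : h 1 ≠ 0 := by
    rw [hh]; intro e
    exact one_ne_zero (hginj 1 0 (sub_eq_zero.mp e))
  obtain ⟨A, hA⟩ : ∃ A : ℝ → ℝ, ∀ s, A s = (h (s + 1) - h s) / h 1 := ⟨_, fun _ => rfl⟩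
  have hadd : ∀ s u, h (s + u) = A s * h u + h s := by
    intro s u
    have := gaff s u
    have e : (h (s + u) - h s) * h 1 = (h (s + 1) - h s) * h u := by
      simp only [hh]; linarith
    rw [hA]
    field_simp
    linarith
  obtain ⟨k, hk⟩ : ∃ k : ℝ, k = (A 1 - 1) / h 1 := ⟨_, rfl⟩
  have hAk : ∀ u, A u = 1 + k * h u := by
    intro u
    have e1 := hadd u 1
    have e2 := hadd 1 u
    rw [add_comm] at e2
    rw [hk]
    field_simp
    linarith
  have hf : ∀ x, 0 < x → f x = h (Real.log x) + g 0 := by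
    intro x hx
    rw [hh, hg (Real.log x), Real.exp_log hx]; ring
  by_cases hk0 : k = 0
  · right
    refine ⟨h 1, g 0, h1, fun x hx => ?_⟩
    rw [hf x hx, cauchy_linear h hhc (fun u v => by rw [hadd, hAk, hk0]; ring) (Real.log x)]
    ring
  · left
    have hm : ∀ u v, 1 + k * h (u + v) = (1 + k * h u) * (1 + k * h v) := by
      intro u v
      rw [hadd, hAk]; ring
    have hne : ∀ u, 1 + k * h u ≠ 0 := by
      intro u e
      have := hm u (-u)
      rw [e, add_neg_cancel, h0] at this
      simp at this
    have hpos : ∀ u, 0 < 1 + k * h u := by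
      intro u
      have := hm (u / 2) (u / 2)
      rw [add_halves] at this
      rw [this]
      exact mul_self_pos.mpr (hne _)
    have hlin := cauchy_linear (fun u => Real.log (1 + k * h u))
      (Continuous.log (by fun_prop) hne)
      (fun u v => by
        show Real.log (1 + k * h (u + v)) = _
        rw [hm, Real.log_mul (hne u) (hne v)])
    refine ⟨1 / k, Real.log (1 + k * h 1), g 0 - 1 / k, by positivity, ?_, ?_⟩
    · intro e
      have e2 := Real.exp_log (hpos 1)
      rw [e, Real.exp_zero] at e2
      have : k * h 1 = 0 := by linarith
      exact (mul_ne_zero hk0 h1) this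
    · intro x hx
      have e := hlin (Real.log x)
      rw [hf x hx, Real.rpow_def_of_pos hx, ← e, Real.exp_log (hpos _)]
      field_simp
      ring
end

section
/- Let (aᵢ) be a sequence of positive reals with aᵢ → 1 and aᵢ ≠ 1 for all i, let (pᵢ) be a sequence of positive reals with pᵢ ≠ 1 for all i, let (qᵢ) be a sequence of reals, and let c ∈ ℝ be such that qᵢ/(pᵢ − 1) = c for all i. If m : (0,∞) → ℝ is continuous and satisfies m(aᵢ·y) = pᵢ·m(y) + qᵢ for all y > 0 and all i, then there exist real numbers α and β with m(y) = α·y^β − c for all y > 0. -/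
/-- Affine-multiplicative functional equation: if `aᵢ → 1`, `aᵢ > 0`, `aᵢ ≠ 1`,
`pᵢ > 0`, `pᵢ ≠ 1`, `qᵢ / (pᵢ - 1) = c` for all `i`, and a continuous `m : (0,∞) → ℝ`
satisfies `m (aᵢ y) = pᵢ m y + qᵢ`, then `m y = α y ^ β - c`. -/
theorem stmt_14 (a p q : ℕ → ℝ) (c : ℝ)
    (ha_pos : ∀ i, 0 < a i) (ha_ne : ∀ i, a i ≠ 1)
    (ha_lim : Filter.Tendsto a Filter.atTop (nhds 1))
    (hp_pos : ∀ i, 0 < p i) (hp_ne : ∀ i, p i ≠ 1)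
    (hq : ∀ i, q i / (p i - 1) = c)
    (m : ℝ → ℝ) (hm_cont : ContinuousOn m (Set.Ioi 0))
    (hfe : ∀ y : ℝ, 0 < y → ∀ i : ℕ, m (a i * y) = p i * m y + q i) :
    ∃ α β : ℝ, ∀ y : ℝ, 0 < y → m y = α * y ^ β - c := by
  obtain ⟨g, hgdef⟩ : ∃ g : ℝ → ℝ, ∀ t, g t = m (Real.exp t) + c := ⟨_, fun _ => rfl⟩
  have hg : Continuous g := by
    have h1 : Continuous fun t => m (Real.exp t) :=
      hm_cont.comp_continuous Real.continuous_exp (fun t => Real.exp_pos t)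
    have h2 : g = fun t => m (Real.exp t) + c := funext hgdef
    rw [h2]
    exact h1.add continuous_const
  let S : AddSubgroup ℝ :=
    { carrier := {s | ∃ P : ℝ, 0 < P ∧ ∀ t, g (t + s) = P * g t}
      zero_mem' := ⟨1, one_pos, fun t => by simp⟩
      add_mem' := by
        rintro x y ⟨P, hP, h⟩ ⟨Q, hQ, k⟩
        refine ⟨Q * P, mul_pos hQ hP, fun t => ?_⟩
        rw [← add_assoc, k, h, mul_assoc]
      neg_mem' := by
        rintro x ⟨P, hP, h⟩
        refine ⟨P⁻¹, inv_pos.2 hP, fun t => ?_⟩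
        have h1 := h (t + -x)
        rw [neg_add_cancel_right] at h1
        rw [h1, inv_mul_cancel_left₀ hP.ne'] }
  have hmem : ∀ i, Real.log (a i) ∈ S := by
    intro i
    refine ⟨p i, hp_pos i, fun t => ?_⟩
    have hq1 : q i = c * (p i - 1) := by
      rw [← hq i, div_mul_cancel₀ _ (sub_ne_zero.2 (hp_ne i))]
    rw [hgdef, hgdef, Real.exp_add, Real.exp_log (ha_pos i), mul_comm, hfe _ (Real.exp_pos t), hq1]
    ring
  have hdense : Dense (S : Set ℝ) := by
    apply AddSubgroup.dense_of_not_isolated_zero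
    intro ε hε
    have hl : Filter.Tendsto (fun i => Real.log (a i)) Filter.atTop (nhds 0) := by
      have := ha_lim.log one_ne_zero
      rwa [Real.log_one] at this
    obtain ⟨i, hi⟩ := (Metric.tendsto_nhds.1 hl ε hε).exists
    rw [Real.dist_eq, sub_zero] at hi
    have hne : Real.log (a i) ≠ 0 := Real.log_ne_zero_of_pos_of_ne_one (ha_pos i) (ha_ne i)
    refine ⟨|Real.log (a i)|, ?_, abs_pos.2 hne, hi⟩
    rcases abs_choice (Real.log (a i)) with h | h <;> rw [h]
    · exact hmem i
    · exact S.neg_mem (hmem i)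
  have hmul : ∀ t s, g (t + s) * g 0 = g s * g t := by
    intro t
    have : (fun s => g (t + s) * g 0) = fun s => g s * g t := by
      refine Continuous.ext_on hdense (by fun_prop) (by fun_prop) ?_
      rintro s ⟨P, hP, h⟩
      have h0 := h 0
      rw [zero_add] at h0
      simp only [h t, h0]
      ring
    exact fun s => congrFun this s
  have hfin : ∀ y, 0 < y → m y = g (Real.log y) - c := by
    intro y hy
    rw [hgdef, Real.exp_log hy]; ring
  by_cases h0 : g 0 = 0
  · refine ⟨0, 0, fun y hy => ?_⟩
    have h1 := hmul (Real.log y) (Real.log y)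
    rw [h0, mul_zero] at h1
    rw [hfin y hy, mul_self_eq_zero.1 h1.symm]
    ring
  · obtain ⟨h, hh⟩ : ∃ h : ℝ → ℝ, ∀ t, h t = g t / g 0 := ⟨_, fun _ => rfl⟩
    have hadd : ∀ t s, h (t + s) = h t * h s := by
      intro t s
      rw [hh, hh, hh]
      field_simp
      linarith [hmul t s]
    have hz : h 0 = 1 := by rw [hh, div_self h0]
    have hne : ∀ t, h t ≠ 0 := by
      intro t ht
      have := hadd t (-t)
      rw [add_neg_cancel, hz, ht, zero_mul] at this
      exact one_ne_zero this
    have hpos : ∀ t, 0 < h t := by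
      intro t
      have := hadd (t / 2) (t / 2)
      rw [add_halves] at this
      rw [this]
      exact mul_self_pos.2 (hne _)
    have hc : Continuous h := by
      have : h = fun t => g t / g 0 := funext hh
      rw [this]
      exact hg.div_const _
    let f : ℝ →+ ℝ := AddMonoidHom.mk' (fun t => Real.log (h t))
      (fun t s => by rw [hadd, Real.log_mul (hne t) (hne s)])
    have hf : Continuous f := hc.log hne
    have hlin : ∀ t, Real.log (h t) = t * Real.log (h 1) := by
      intro t
      have := (f.toRealLinearMap hf).map_smul t 1
      simpa [f] using this
    refine ⟨g 0, Real.log (h 1), fun y hy => ?_⟩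
    rw [hfin y hy, Real.rpow_def_of_pos hy, ← hlin, Real.exp_log (hpos _), hh,
      mul_div_cancel₀ _ h0]
end

section
/- Let (bᵢ) be a sequence of reals with bᵢ → 0 and bᵢ ≠ 0 for all i, let (pᵢ) be a sequence of positive reals with pᵢ ≠ 1 for all i, let (qᵢ) be a sequence of reals, and let c ∈ ℝ be such that qᵢ/(pᵢ − 1) = c for all i. If m : ℝ → ℝ is continuous and satisfies m(y + bᵢ) = pᵢ·m(y) + qᵢ for all y ∈ ℝ and all i, then there exist real numbers α and β with m(y) = α·exp(β·y) − c for all y ∈ ℝ. -/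
/-- Affine-translational functional equation: if `bᵢ → 0`, `bᵢ ≠ 0`,
`pᵢ > 0`, `pᵢ ≠ 1`, `qᵢ / (pᵢ - 1) = c` for all `i`, and a continuous `m : ℝ → ℝ`
satisfies `m (y + bᵢ) = pᵢ m y + qᵢ`, then `m y = α exp (β y) - c`. -/
theorem stmt_15 (b p q : ℕ → ℝ) (c : ℝ)
    (hb_ne : ∀ i, b i ≠ 0)
    (hb_lim : Filter.Tendsto b Filter.atTop (nhds 0))
    (hp_pos : ∀ i, 0 < p i) (hp_ne : ∀ i, p i ≠ 1)
    (hq : ∀ i, q i / (p i - 1) = c)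
    (m : ℝ → ℝ) (hm_cont : Continuous m)
    (hfe : ∀ y : ℝ, ∀ i : ℕ, m (y + b i) = p i * m y + q i) :
    ∃ α β : ℝ, ∀ y : ℝ, m y = α * Real.exp (β * y) - c := by
  obtain ⟨g, hg⟩ : ∃ g : ℝ → ℝ, g = fun y => m y + c := ⟨_, rfl⟩
  have hgc : Continuous g := by rw [hg]; fun_prop
  have hgfe : ∀ y i, g (y + b i) = p i * g y := by
    intro y i
    have h1 : p i - 1 ≠ 0 := sub_ne_zero.mpr (hp_ne i)
    have h2 : q i = c * (p i - 1) := by rw [← hq i]; field_simp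
    simp only [hg, hfe, h2]; ring
  let H : AddSubgroup ℝ :=
    { carrier := {s | ∃ r : ℝ, r ≠ 0 ∧ ∀ y, g (y + s) = r * g y}
      zero_mem' := ⟨1, one_ne_zero, fun y => by simp⟩
      add_mem' := by
        rintro s t ⟨r, hr, h⟩ ⟨r', hr', h'⟩
        refine ⟨r' * r, mul_ne_zero hr' hr, fun y => ?_⟩
        rw [← add_assoc, h', h, mul_assoc]
      neg_mem' := by
        rintro s ⟨r, hr, h⟩
        refine ⟨r⁻¹, inv_ne_zero hr, fun y => ?_⟩
        have := h (y + -s)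
        rw [neg_add_cancel_right] at this
        rw [this, inv_mul_cancel_left₀ hr] }
  have hbH : ∀ i, b i ∈ H := fun i => ⟨p i, (hp_pos i).ne', fun y => hgfe y i⟩
  have hd : Dense (H : Set ℝ) := by
    apply AddSubgroup.dense_of_not_isolated_zero
    intro ε hε
    obtain ⟨i, hi⟩ := (hb_lim.eventually (Metric.ball_mem_nhds (0 : ℝ) hε)).exists
    have hi' : |b i| < ε := by simpa using hi
    refine ⟨|b i|, ?_, abs_pos.mpr (hb_ne i), hi'⟩
    rcases abs_choice (b i) with h | h <;> rw [h]
    · exact hbH i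
    · exact H.neg_mem (hbH i)
  have key : ∀ y s, g (y + s) * g 0 = g s * g y := by
    intro y
    have : (fun s => g (y + s) * g 0) = fun s => g s * g y := by
      apply Continuous.ext_on hd (by fun_prop) (by fun_prop)
      rintro s ⟨r, hr, h⟩
      have h0 := h 0
      rw [zero_add] at h0
      simp only [h, h0]; ring
    exact fun s => congrFun this s
  have hmg : ∀ y, m y = g y - c := fun y => by simp [hg]
  by_cases h0 : g 0 = 0
  · refine ⟨0, 0, fun y => ?_⟩
    have := key y y
    rw [h0, mul_zero] at this
    rw [hmg, mul_self_eq_zero.mp this.symm]; simp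
  have hne : ∀ x, g x / g 0 ≠ 0 := by
    intro x hx
    have hx' : g x = 0 := by simpa [h0] using hx
    have := key (-x) x
    rw [hx', neg_add_cancel] at this
    simp [h0] at this
  have hmul : ∀ x y, g (x + y) / g 0 = g x / g 0 * (g y / g 0) := by
    intro x y
    have := key x y
    field_simp
    linarith
  have hpos : ∀ x, 0 < g x / g 0 := by
    intro x
    have h := hmul (x / 2) (x / 2)
    rw [add_halves] at h
    rw [h]
    exact mul_self_pos.mpr (hne _)
  let L : ℝ →+ ℝ := AddMonoidHom.mk' (fun x => Real.log (g x / g 0)) (by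
    intro x y
    simp only [hmul x y]
    exact Real.log_mul (hne x) (hne y))
  have hL : Continuous L := by
    change Continuous fun x => Real.log (g x / g 0)
    exact (hgc.div_const _).log hne
  refine ⟨g 0, L 1, fun y => ?_⟩
  have h1 : L y = L 1 * y := by
    have := (L.toRealLinearMap hL).map_smul y 1
    simpa [mul_comm] using this
  rw [← h1]
  change m y = g 0 * Real.exp (Real.log (g y / g 0)) - c
  rw [Real.exp_log (hpos y), hmg]
  field_simp
end
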